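/- Let n ≥ 2, q ≥ 0 and p ∈ ℝ, and suppose the Liouville property holds for (p,q) in dimension n. Then there exists a constant C = C(n,p,q) > 0 such that for every domain Ω ⊊ ℝ^n with nonempty boundary and every positive classical solution u of Δu + |∇u|^q u^p = 0 on Ω, one has (|∇u(x)|²/u(x)² + |∇u(x)|^q u(x)^{p−1}) ≤ C / dist(x, ∂Ω)² for every x ∈ Ω. -/

import Mathlib

open scoped BigOperators

/-- The Euclidean Laplacian of `u : ℝⁿ → ℝ`, defined as the sum of the second
partial derivatives in the coordinate directions. -/
noncomputable def elaplacian {n : ℕ} (u : EuclideanSpace ℝ (Fin n) → ℝ)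
    (x : EuclideanSpace ℝ (Fin n)) : ℝ :=
  ∑ i : Fin n, fderiv ℝ (fun y => fderiv ℝ u y (EuclideanSpace.single i 1)) x
    (EuclideanSpace.single i 1)

section

open Filter Topology Set Metric Laplacian InnerProductSpace

variable {E : Type*} [NormedAddCommGroup E] [InnerProductSpace ℝ E]

/-- `h` has the second order expansion `a + b t + c t² / 2` at `t = 0`, in the sense that it is
differentiable near `0` and its derivative is differentiable at `0`. -/
def HasJet (h : ℝ → ℝ) (a b c : ℝ) : Prop :=
  ∃ g : ℝ → ℝ, (∀ᶠ t in 𝓝 0, HasDerivAt h (g t) t) ∧ h 0 = a ∧ g 0 = b ∧ HasDerivAt g c 0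

namespace HasJet

variable {h h₁ h₂ : ℝ → ℝ} {a b c a₁ b₁ c₁ a₂ b₂ c₂ : ℝ}

theorem congr_coeff (H : HasJet h a b c) (ha : a = a₁) (hb : b = b₁) (hc : c = c₁) :
    HasJet h a₁ b₁ c₁ := by
  subst ha hb hc; exact H

theorem affine (a b : ℝ) : HasJet (fun t => a + t * b) a b 0 := by
  refine ⟨fun _ => b, Eventually.of_forall fun t => ?_, by simp, rfl, hasDerivAt_const _ _⟩
  simpa using ((hasDerivAt_id t).mul_const b).const_add a

theorem const (a : ℝ) : HasJet (fun _ => a) a 0 0 :=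
  ⟨fun _ => 0, Eventually.of_forall fun _ => hasDerivAt_const _ _, rfl, rfl, hasDerivAt_const _ _⟩

theorem add (H₁ : HasJet h₁ a₁ b₁ c₁) (H₂ : HasJet h₂ a₂ b₂ c₂) :
    HasJet (fun t => h₁ t + h₂ t) (a₁ + a₂) (b₁ + b₂) (c₁ + c₂) := by
  obtain ⟨g₁, d₁, rfl, rfl, e₁⟩ := H₁
  obtain ⟨g₂, d₂, rfl, rfl, e₂⟩ := H₂
  refine ⟨fun t => g₁ t + g₂ t, ?_, rfl, rfl, e₁.add e₂⟩
  filter_upwards [d₁, d₂] with t k₁ k₂ using k₁.add k₂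

theorem mul (H₁ : HasJet h₁ a₁ b₁ c₁) (H₂ : HasJet h₂ a₂ b₂ c₂) :
    HasJet (fun t => h₁ t * h₂ t) (a₁ * a₂) (b₁ * a₂ + a₁ * b₂)
      (c₁ * a₂ + 2 * (b₁ * b₂) + a₁ * c₂) := by
  obtain ⟨g₁, d₁, rfl, rfl, e₁⟩ := H₁
  obtain ⟨g₂, d₂, rfl, rfl, e₂⟩ := H₂
  refine ⟨fun t => g₁ t * h₂ t + h₁ t * g₂ t, ?_, rfl, rfl, ?_⟩
  · filter_upwards [d₁, d₂] with t k₁ k₂ using k₁.mul k₂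
  · exact ((e₁.mul d₂.self_of_nhds).add (d₁.self_of_nhds.mul e₂)).congr_deriv (by ring)

theorem const_mul (k : ℝ) (H : HasJet h a b c) :
    HasJet (fun t => k * h t) (k * a) (k * b) (k * c) :=
  ((const k).mul H).congr_coeff rfl (by ring) (by ring)

theorem sub (H₁ : HasJet h₁ a₁ b₁ c₁) (H₂ : HasJet h₂ a₂ b₂ c₂) :
    HasJet (fun t => h₁ t - h₂ t) (a₁ - a₂) (b₁ - b₂) (c₁ - c₂) := by
  simpa [sub_eq_add_neg] using H₁.add (H₂.const_mul (-1))

theorem comp {f f' : ℝ → ℝ} {f'' : ℝ} (H : HasJet h a b c)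
    (hf : ∀ᶠ s in 𝓝 a, HasDerivAt f (f' s) s) (hf' : HasDerivAt f' f'' a) :
    HasJet (fun t => f (h t)) (f a) (f' a * b) (f'' * b ^ 2 + f' a * c) := by
  obtain ⟨g, d, rfl, rfl, e⟩ := H
  refine ⟨fun t => f' (h t) * g t, ?_, rfl, rfl, ?_⟩
  · filter_upwards [d, d.self_of_nhds.continuousAt.eventually hf] with t k₁ k₂ using k₂.comp t k₁
  · exact ((hf'.comp 0 d.self_of_nhds).mul e).congr_deriv (by simp only [Function.comp]; ring)

theorem rpow (H : HasJet h a b c) (ha : 0 < a) (s : ℝ) :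
    HasJet (fun t => h t ^ s) (a ^ s) (s * a ^ (s - 1) * b)
      (s * (s - 1) * a ^ (s - 2) * b ^ 2 + s * a ^ (s - 1) * c) := by
  refine (H.comp (f := fun y => y ^ s) (f' := fun y => s * y ^ (s - 1)) ?_
    ((Real.hasDerivAt_rpow_const (Or.inl ha.ne')).const_mul s)).congr_coeff rfl rfl ?_
  · filter_upwards [eventually_gt_nhds ha] with y hy
      using Real.hasDerivAt_rpow_const (Or.inl hy.ne')
  · rw [show s - 1 - 1 = s - 2 by ring]; ring

theorem eq_zero_and_nonpos_of_isLocalMax (H : HasJet h a b c) (hm : IsLocalMax h 0) :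
    b = 0 ∧ c ≤ 0 := by
  obtain ⟨g, d, rfl, rfl, e⟩ := H
  have hg : deriv h =ᶠ[𝓝 0] g := by filter_upwards [d] with t ht using ht.deriv
  have h1 : deriv h 0 = 0 := hm.deriv_eq_zero
  have h2 : deriv (deriv h) 0 = c := by rw [hg.deriv_eq]; exact e.deriv
  refine ⟨by rw [← hg.self_of_nhds, h1], ?_⟩
  by_contra! hc
  have hmin := isLocalMin_of_deriv_deriv_pos (h2 ▸ hc) h1 d.self_of_nhds.continuousAt
  have hconst : h =ᶠ[𝓝 0] fun _ => h 0 := by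
    filter_upwards [hm, hmin] with t k₁ k₂ using le_antisymm k₁ k₂
  have : deriv (deriv h) 0 = 0 := by
    rw [hconst.deriv.deriv_eq]; simp
  linarith

end HasJet

theorem ContDiffAt.hasJet {v : E → ℝ} {x : E} (hv : ContDiffAt ℝ 2 v x) (ξ : E) :
    HasJet (fun t : ℝ => v (x + t • ξ)) (v x) (fderiv ℝ v x ξ)
      (fderiv ℝ (fderiv ℝ v) x ξ ξ) := by
  have hl : ∀ t : ℝ, HasDerivAt (fun t : ℝ => x + t • ξ) ξ t := fun t => by
    simpa using ((hasDerivAt_id t).smul_const ξ).const_add x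
  have h0 : x + (0 : ℝ) • ξ = x := by simp
  have h1 : ∀ᶠ y in 𝓝 x, DifferentiableAt ℝ v y := by
    filter_upwards [hv.eventually (by simp)] with y hy using hy.differentiableAt (by simp)
  have h2 : DifferentiableAt ℝ (fderiv ℝ v) x :=
    (hv.fderiv_right (m := 1) (by norm_num)).differentiableAt (by simp)
  refine ⟨fun t => fderiv ℝ v (x + t • ξ) ξ, ?_, by simp, by simp, ?_⟩
  · have : ∀ᶠ t : ℝ in 𝓝 0, DifferentiableAt ℝ v (x + t • ξ) :=
      (hl 0).continuousAt.eventually (by simpa using h1)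
    filter_upwards [this] with t ht using ht.hasFDerivAt.comp_hasDerivAt t (hl t)
  · have h3 : HasFDerivAt (fderiv ℝ v) (fderiv ℝ (fderiv ℝ v) x) (x + (0 : ℝ) • ξ) := by
      rw [h0]; exact h2.hasFDerivAt
    have h4 : HasDerivAt (fun t : ℝ => fderiv ℝ v (x + t • ξ)) (fderiv ℝ (fderiv ℝ v) x ξ) 0 :=
      h3.comp_hasDerivAt (0 : ℝ) (hl 0)
    exact (h4.clm_apply (hasDerivAt_const (0 : ℝ) ξ)).congr_deriv (by simp)

theorem laplacian_eq_sum_fderiv_fderiv [FiniteDimensional ℝ E] {ι : Type*} [Fintype ι] (b : OrthonormalBasis ι ℝ E)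
    (v : E → ℝ) (x : E) : Δ v x = ∑ i, fderiv ℝ (fderiv ℝ v) x (b i) (b i) := by
  rw [laplacian_eq_iteratedFDeriv_orthonormalBasis v b]
  simp [iteratedFDeriv_two_apply]

theorem not_isLocalMax_of_hasJet {ι : Type*} [Fintype ι] {f : E → ℝ} {x : E} {ξ : ι → E}
    {β c : ι → ℝ} (hj : ∀ i, HasJet (fun t : ℝ => f (x + t • ξ i)) (f x) (β i) (c i))
    (hc : 0 < ∑ i, c i) : ¬ IsLocalMax f x := by
  intro hm
  refine absurd hc (not_lt.2 (Finset.sum_nonpos fun i _ => ?_))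
  refine ((hj i).eq_zero_and_nonpos_of_isLocalMax ?_).2
  have hl : ContinuousAt (fun t : ℝ => x + t • ξ i) 0 := by fun_prop
  have := hl.eventually (p := fun y => f y ≤ f x) (by simpa [IsLocalMax, IsMaxFilter] using hm)
  simpa [IsLocalMax, IsMaxFilter] using this

theorem nonpos_of_forall_not_isLocalMax {X : Type*} [TopologicalSpace X] {K S : Set X} {f : X → ℝ} (hK : IsCompact K)
    (hS : IsOpen S) (hSK : S ⊆ K) (hf : ContinuousOn f K) (hm : ∀ x ∈ S, ¬ IsLocalMax f x)
    (hb : ∀ x ∈ K, x ∉ S → f x ≤ 0) {x : X} (hx : x ∈ K) : f x ≤ 0 := by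
  obtain ⟨y, hy, hmax⟩ := hK.exists_isMaxOn ⟨x, hx⟩ hf
  refine (hmax hx).trans ?_
  by_cases hyS : y ∈ S
  · exact absurd (hmax.isLocalMax (mem_of_superset (hS.mem_nhds hyS) hSK)) (hm y hyS)
  · exact hb y hy hyS

/-- Reflection through the hyperplane orthogonal to `e`. -/
noncomputable abbrev hyperRefl (e : E) : E ≃ₗᵢ[ℝ] E := (ℝ ∙ e)ᗮ.reflection

theorem hyperRefl_apply {e : E} (he : ‖e‖ = 1) (z : E) :
    hyperRefl e z = z - (2 * inner ℝ e z) • e := by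
  rw [hyperRefl, Submodule.reflection_orthogonal_apply, Submodule.reflection_singleton_apply]
  simp [he, mul_smul, two_smul]

theorem sum_inner_basis_mul {ι : Type*} [Fintype ι] (b : OrthonormalBasis ι ℝ E) (x y : E) :
    ∑ i, inner ℝ x (b i) * inner ℝ y (b i) = inner ℝ x y := by
  rw [← b.sum_inner_mul_inner x y]
  exact Finset.sum_congr rfl fun i _ => by rw [real_inner_comm (b i) y]

theorem hasJet_inner (e x ξ : E) :
    HasJet (fun t : ℝ => inner ℝ e (x + t • ξ)) (inner ℝ e x) (inner ℝ e ξ) 0 := by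
  simpa [inner_add_right, inner_smul_right] using HasJet.affine (inner ℝ e x) (inner ℝ e ξ)

theorem hasJet_norm_sq (x ξ : E) :
    HasJet (fun t : ℝ => ‖x + t • ξ‖ ^ 2) (‖x‖ ^ 2) (2 * inner ℝ x ξ) (2 * ‖ξ‖ ^ 2) := by
  have h : (fun t : ℝ => ‖x + t • ξ‖ ^ 2) = fun t =>
      (‖x‖ ^ 2 + t * (2 * inner ℝ x ξ)) + (0 + t * ‖ξ‖) * (0 + t * ‖ξ‖) := by
    ext t
    rw [norm_add_sq_real, norm_smul, inner_smul_right, mul_pow, Real.norm_eq_abs, sq_abs]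
    ring
  rw [h]
  exact ((HasJet.affine _ _).add ((HasJet.affine 0 ‖ξ‖).mul (HasJet.affine 0 ‖ξ‖))).congr_coeff
    (by ring) (by ring) (by ring)

/-- `f` has second order expansions at `x` along the vectors of `b`, and its second derivatives
along these vectors add up to `l`. -/
def HasLapJet {ι : Type*} [Fintype ι] (b : ι → E) (f : E → ℝ) (x : E) (l : ℝ) : Prop :=
  ∃ β c : ι → ℝ, (∀ i, HasJet (fun t : ℝ => f (x + t • b i)) (f x) (β i) (c i)) ∧ ∑ i, c i = l

namespace HasLapJet

variable {ι : Type*} [Fintype ι] {b : ι → E} {f f₁ f₂ : E → ℝ} {x : E} {l l₁ l₂ : ℝ}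

theorem add (H₁ : HasLapJet b f₁ x l₁) (H₂ : HasLapJet b f₂ x l₂) :
    HasLapJet b (fun y => f₁ y + f₂ y) x (l₁ + l₂) := by
  obtain ⟨β₁, c₁, h₁, rfl⟩ := H₁
  obtain ⟨β₂, c₂, h₂, rfl⟩ := H₂
  exact ⟨_, _, fun i => (h₁ i).add (h₂ i), Finset.sum_add_distrib⟩

theorem sub (H₁ : HasLapJet b f₁ x l₁) (H₂ : HasLapJet b f₂ x l₂) :
    HasLapJet b (fun y => f₁ y - f₂ y) x (l₁ - l₂) := by
  obtain ⟨β₁, c₁, h₁, rfl⟩ := H₁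
  obtain ⟨β₂, c₂, h₂, rfl⟩ := H₂
  exact ⟨_, _, fun i => (h₁ i).sub (h₂ i), Finset.sum_sub_distrib _ _⟩

theorem const_mul (k : ℝ) (H : HasLapJet b f x l) :
    HasLapJet b (fun y => k * f y) x (k * l) := by
  obtain ⟨β, c, h, rfl⟩ := H
  exact ⟨_, _, fun i => (h i).const_mul k, (Finset.mul_sum _ _ _).symm⟩

theorem not_isLocalMax (H : HasLapJet b f x l) (hl : 0 < l) : ¬ IsLocalMax f x := by
  obtain ⟨β, c, h, rfl⟩ := H
  exact not_isLocalMax_of_hasJet h hl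

end HasLapJet

section Blocks

variable {ι : Type*} [Fintype ι] (b : OrthonormalBasis ι ℝ E)

theorem hasLapJet_inner (e z : E) : HasLapJet b (fun y => inner ℝ e y) z 0 :=
  ⟨_, _, fun i => hasJet_inner e z (b i), by simp⟩

theorem hasLapJet_norm_sq (z : E) :
    HasLapJet b (fun y => ‖y‖ ^ 2) z (2 * Fintype.card ι) :=
  ⟨_, _, fun i => hasJet_norm_sq z (b i), by simp [mul_comm]⟩

theorem hasLapJet_inner_mul_inner (e e' z : E) :
    HasLapJet b (fun y => inner ℝ e y * inner ℝ e' y) z (2 * inner ℝ e e') := by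
  refine ⟨_, _, fun i => (hasJet_inner e z (b i)).mul (hasJet_inner e' z (b i)), ?_⟩
  simp only [zero_mul, mul_zero, zero_add, add_zero, ← Finset.mul_sum, sum_inner_basis_mul]

theorem sum_sq_inner_mul_inner {e e' : E} (he : ‖e‖ = 1) (he' : ‖e'‖ = 1)
    (hee : inner ℝ e e' = 0) (z : E) :
    ∑ i, (inner ℝ e (b i) * inner ℝ e' z + inner ℝ e z * inner ℝ e' (b i)) ^ 2
      = inner ℝ e z ^ 2 + inner ℝ e' z ^ 2 := by
  have h1 := sum_inner_basis_mul b e e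
  have h2 := sum_inner_basis_mul b e' e'
  have h3 := sum_inner_basis_mul b e e'
  rw [real_inner_self_eq_norm_sq, he] at h1
  rw [real_inner_self_eq_norm_sq, he'] at h2
  rw [hee] at h3
  calc _ = ∑ i, ((inner ℝ e' z) ^ 2 * (inner ℝ e (b i) * inner ℝ e (b i))
        + 2 * inner ℝ e z * inner ℝ e' z * (inner ℝ e (b i) * inner ℝ e' (b i))
        + (inner ℝ e z) ^ 2 * (inner ℝ e' (b i) * inner ℝ e' (b i))) :=
        Finset.sum_congr rfl fun i _ => by ring
    _ = _ := by
      rw [Finset.sum_add_distrib, Finset.sum_add_distrib, ← Finset.mul_sum, ← Finset.mul_sum,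
        ← Finset.mul_sum, h1, h2, h3]
      ring

theorem hasLapJet_rpow {e e' : E} (he : ‖e‖ = 1) (he' : ‖e'‖ = 1)
    (hee : inner ℝ e e' = 0) {z : E} (hz : 0 < inner ℝ e z * inner ℝ e' z) (s : ℝ) :
    HasLapJet b (fun y => (inner ℝ e y * inner ℝ e' y) ^ s) z
      (s * (s - 1) * (inner ℝ e z * inner ℝ e' z) ^ (s - 2)
        * (inner ℝ e z ^ 2 + inner ℝ e' z ^ 2)) := by
  refine ⟨_, _, fun i =>
    (((hasJet_inner e z (b i)).mul (hasJet_inner e' z (b i))).rpow hz s), ?_⟩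
  have h3 := sum_inner_basis_mul b e e'
  rw [hee] at h3
  rw [Finset.sum_add_distrib, ← Finset.mul_sum, ← Finset.mul_sum,
    sum_sq_inner_mul_inner b he he' hee]
  simp only [zero_mul, mul_zero, zero_add, add_zero, ← Finset.mul_sum, h3]

theorem hasLapJet_rpow_half_mul_norm_sq {e e' : E} (he : ‖e‖ = 1) (he' : ‖e'‖ = 1)
    (hee : inner ℝ e e' = 0) {z : E} (hz : 0 < inner ℝ e z * inner ℝ e' z) :
    ∃ l, HasLapJet b (fun y => (inner ℝ e y * inner ℝ e' y) ^ (1 / 2 : ℝ) * ‖y‖ ^ 2) z l ∧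
      l ≤ (2 * Fintype.card ι + 4) * (inner ℝ e z * inner ℝ e' z) ^ (1 / 2 : ℝ) := by
  refine ⟨_, ⟨_, _, fun i => (((hasJet_inner e z (b i)).mul (hasJet_inner e' z (b i))).rpow hz
    (1 / 2)).mul (hasJet_norm_sq z (b i)), rfl⟩, ?_⟩
  have h3 := sum_inner_basis_mul b e e'
  have h4 := sum_inner_basis_mul b e z
  have h5 := sum_inner_basis_mul b e' z
  rw [hee] at h3
  set P := inner ℝ e z * inner ℝ e' z with hP
  have hpow : P ^ (1 / 2 - 1 : ℝ) * P = P ^ (1 / 2 : ℝ) := by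
    conv_lhs => rw [← Real.rpow_add_one hz.ne']
    norm_num
  set A := P ^ (1 / 2 - 1 : ℝ)
  have hA2 : 0 ≤ P ^ (1 / 2 - 2 : ℝ) := Real.rpow_nonneg hz.le _
  set A2 := P ^ (1 / 2 - 2 : ℝ)
  calc _ = ∑ i, ((-(1 / 4) * A2 * ‖z‖ ^ 2) *
        (inner ℝ e (b i) * inner ℝ e' z + inner ℝ e z * inner ℝ e' (b i)) ^ 2
        + (A * ‖z‖ ^ 2) * (inner ℝ e (b i) * inner ℝ e' (b i))
        + (2 * A * inner ℝ e' z) * (inner ℝ e (b i) * inner ℝ z (b i))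
        + (2 * A * inner ℝ e z) * (inner ℝ e' (b i) * inner ℝ z (b i))
        + 2 * P ^ (1 / 2 : ℝ)) := Finset.sum_congr rfl fun i _ => by
          rw [b.norm_eq_one]; ring
    _ = (-(1 / 4) * A2 * ‖z‖ ^ 2) * (inner ℝ e z ^ 2 + inner ℝ e' z ^ 2)
        + 4 * (A * P) + 2 * Fintype.card ι * P ^ (1 / 2 : ℝ) := by
      simp only [Finset.sum_add_distrib, ← Finset.mul_sum, h3, h4, h5,
        sum_sq_inner_mul_inner b he he' hee, Finset.sum_const, Finset.card_univ, nsmul_eq_mul]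
      rw [hP]; ring
    _ ≤ _ := by
      rw [hpow]
      have : 0 ≤ A2 * ‖z‖ ^ 2 * (inner ℝ e z ^ 2 + inner ℝ e' z ^ 2) := by positivity
      linarith

theorem ContDiffAt.hasJet_comp {v : E → ℝ} {x₀ z : E} (R : E ≃ₗᵢ[ℝ] E)
    (hv : ContDiffAt ℝ 2 v (x₀ + R z)) (ξ : E) :
    HasJet (fun t : ℝ => v (x₀ + R (z + t • ξ))) (v (x₀ + R z))
      (fderiv ℝ v (x₀ + R z) (R ξ)) (fderiv ℝ (fderiv ℝ v) (x₀ + R z) (R ξ) (R ξ)) := by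
  have := hv.hasJet (R ξ)
  simpa only [map_add, map_smul, add_assoc] using this

theorem ContDiffAt.hasLapJet_comp [FiniteDimensional ℝ E] {v : E → ℝ} {x₀ z : E}
    (R : E ≃ₗᵢ[ℝ] E) (hv : ContDiffAt ℝ 2 v (x₀ + R z)) :
    HasLapJet b (fun y => v (x₀ + R y)) z (Δ v (x₀ + R z)) :=
  ⟨_, _, fun i => hv.hasJet_comp R (b i), by
    rw [laplacian_eq_sum_fderiv_fderiv (b.map R)]; rfl⟩

end Blocks

theorem deriv_nonpos_of_eventually_nonpos {g : ℝ → ℝ} {m : ℝ} (hg : HasDerivAt g m 0)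
    (h0 : g 0 = 0) (h : ∀ᶠ t in 𝓝[>] 0, g t ≤ 0) : m ≤ 0 := by
  have h1 := hg.hasDerivWithinAt (s := Ioi 0)
  rw [hasDerivWithinAt_iff_tendsto_slope' (by simp)] at h1
  refine le_of_tendsto h1 ?_
  filter_upwards [h, self_mem_nhdsWithin] with t ht ht0
  rw [slope_def_field, h0, sub_zero, sub_zero]
  exact div_nonpos_of_nonpos_of_nonneg ht (le_of_lt ht0)

/-- Interior gradient estimate for the Poisson equation. -/
theorem fderiv_apply_le_of_laplacian_lt [FiniteDimensional ℝ E] {v : E → ℝ} {x₀ e : E}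
    {d M F : ℝ} (hd : 0 < d) (he : ‖e‖ = 1)
    (hv : ∀ x ∈ closedBall x₀ d, ContDiffAt ℝ 2 v x)
    (hM : ∀ x ∈ closedBall x₀ d, |v x| ≤ M) (hF : ∀ x ∈ closedBall x₀ d, |Δ v x| < F) :
    fderiv ℝ v x₀ e ≤ Module.finrank ℝ E * M / d + F * d / 2 := by
  set n : ℝ := ((Module.finrank ℝ E : ℕ) : ℝ) with hn
  have hx₀ : x₀ ∈ closedBall x₀ d := mem_closedBall_self hd.le
  have hM0 : 0 ≤ M := (abs_nonneg _).trans (hM _ hx₀)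
  have hF0 : 0 < F := (abs_nonneg _).trans_lt (hF _ hx₀)
  let b := stdOrthonormalBasis ℝ E
  let I := LinearIsometryEquiv.refl ℝ E
  let R := hyperRefl e
  have hball : ∀ (T : E ≃ₗᵢ[ℝ] E) {z : E}, ‖z‖ ≤ d → x₀ + T z ∈ closedBall x₀ d := by
    intro T z hz; simpa using hz
  let B : E → ℝ := fun z => M / d ^ 2 * (‖z‖ ^ 2 + n * (d * inner ℝ e z
    - inner ℝ e z * inner ℝ e z)) + F / 2 * (d * inner ℝ e z - inner ℝ e z * inner ℝ e z)
  let f : E → ℝ := fun z => 1 / 2 * (v (x₀ + I z) - v (x₀ + R z)) - B z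
  have hee : inner ℝ e e = 1 := by rw [real_inner_self_eq_norm_sq, he]; norm_num
  have c1 : Continuous fun z : E => inner ℝ e z := by fun_prop
  have c2 : Continuous fun z : E => ‖z‖ := continuous_norm
  have key : ∀ z ∈ {z : E | 0 ≤ inner ℝ e z ∧ ‖z‖ ≤ d}, f z ≤ 0 := by
    intro z hz
    refine nonpos_of_forall_not_isLocalMax (S := {z : E | 0 < inner ℝ e z ∧ ‖z‖ < d}) ?_ ?_ ?_ ?_
      ?_ ?_ hz
    · refine (isCompact_closedBall (0 : E) d).of_isClosed_subset ?_ fun z hz => by simpa using hz.2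
      exact (isClosed_le continuous_const c1).inter
        (isClosed_le c2 continuous_const)
    · exact (isOpen_lt continuous_const c1).inter
        (isOpen_lt c2 continuous_const)
    · exact fun z hz => ⟨hz.1.le, hz.2.le⟩
    · have hc : ∀ T : E ≃ₗᵢ[ℝ] E, ContinuousOn (fun z => v (x₀ + T z))
          {z : E | 0 ≤ inner ℝ e z ∧ ‖z‖ ≤ d} := fun T z hz =>
        ContinuousAt.continuousWithinAt (ContinuousAt.comp (f := fun z => x₀ + T z)
          (hv _ (hball T hz.2)).continuousAt (by fun_prop))
      refine (continuousOn_const.mul ((hc I).sub (hc R))).sub (Continuous.continuousOn ?_)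
      fun_prop
    · intro z hz
      have hi := hasLapJet_inner b e z
      have hs := hasLapJet_inner_mul_inner b e e z
      refine ((((hv _ (hball I hz.2.le)).hasLapJet_comp b I).sub
        ((hv _ (hball R hz.2.le)).hasLapJet_comp b R)).const_mul (1 / 2)).sub
        ((((hasLapJet_norm_sq b z).add (((hi.const_mul d).sub hs).const_mul n)).const_mul
          (M / d ^ 2)).add (((hi.const_mul d).sub hs).const_mul (F / 2))) |>.not_isLocalMax ?_
      have h1 := abs_lt.1 (hF _ (hball I hz.2.le))
      have h2 := abs_lt.1 (hF _ (hball R hz.2.le))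
      rw [hee, Fintype.card_fin, ← hn]
      ring_nf
      linarith [h1.1, h2.2]
    · intro z hz hzS
      have hle : inner ℝ e z ≤ ‖z‖ := by simpa [he] using real_inner_le_norm e z
      have hz1 := hz.1
      have hz2 := hz.2
      by_cases hz0 : inner ℝ e z = 0
      · have : R z = z := by rw [hyperRefl_apply he, hz0]; simp
        have h3 : 0 ≤ M / d ^ 2 * ‖z‖ ^ 2 := by positivity
        simp only [f, B, this, hz0, I, LinearIsometryEquiv.coe_refl, id]
        linarith
      · have hzd : ‖z‖ = d := by
          by_contra hne
          exact hzS ⟨lt_of_le_of_ne hz.1 (Ne.symm hz0), lt_of_le_of_ne hz.2 hne⟩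
        have h1 := abs_le.1 (hM _ (hball I hz.2))
        have h2 := abs_le.1 (hM _ (hball R hz.2))
        have h3 : 0 ≤ d * inner ℝ e z - inner ℝ e z * inner ℝ e z := by nlinarith
        have h4 : 0 ≤ M / d ^ 2 * (n * (d * inner ℝ e z - inner ℝ e z * inner ℝ e z)) := by
          have : 0 ≤ n := by rw [hn]; positivity
          positivity
        have h5 : M / d ^ 2 * ‖z‖ ^ 2 = M := by rw [hzd]; field_simp
        have h6 : 0 ≤ F / 2 * (d * inner ℝ e z - inner ℝ e z * inner ℝ e z) := by positivity
        simp only [f, B]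
        linarith [h1.2, h2.1]
  have hjet := ((((hv _ (hball I (z := 0) (by simpa using hd.le))).hasJet_comp I e).sub
    ((hv _ (hball R (z := 0) (by simpa using hd.le))).hasJet_comp R e)).const_mul (1 / 2)).sub
    ((((hasJet_norm_sq 0 e).add ((((hasJet_inner e 0 e).const_mul d).sub
      ((hasJet_inner e 0 e).mul (hasJet_inner e 0 e))).const_mul n)).const_mul
          (M / d ^ 2)).add ((((hasJet_inner e 0 e).const_mul d).sub
      ((hasJet_inner e 0 e).mul (hasJet_inner e 0 e))).const_mul (F / 2)))
  obtain ⟨g, hg, h0, hg0, -⟩ := hjet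
  have hRe : R e = -e := by
    rw [hyperRefl_apply he, hee]; module
  have h3 := deriv_nonpos_of_eventually_nonpos hg.self_of_nhds (by simp [I]) ?_
  · rw [hg0] at h3
    simp only [map_zero, add_zero, hRe, map_neg, hee, inner_zero_left, inner_zero_right, I,
      LinearIsometryEquiv.coe_refl, id] at h3
    have : M / d ^ 2 * (n * d) = n * M / d := by field_simp
    linarith
  · filter_upwards [Ioc_mem_nhdsGT hd] with t ht
    refine key (0 + t • e) ⟨?_, ?_⟩
    · simp only [zero_add, inner_smul_right, hee]; linarith [ht.1]
    · simp [norm_smul, he, abs_of_pos ht.1, ht.2]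

theorem two_mul_rpow_le_sq_add_sq_mul_rpow {s₁ s₂ : ℝ} (h₁ : 0 < s₁) (h₂ : 0 < s₂) (r : ℝ) :
    2 * (s₁ * s₂) ^ (r - 1) ≤ (s₁ * s₂) ^ (r - 2) * (s₁ ^ 2 + s₂ ^ 2) := by
  have hP : 0 < s₁ * s₂ := mul_pos h₁ h₂
  have : (s₁ * s₂) ^ (r - 1) = (s₁ * s₂) ^ (r - 2) * (s₁ * s₂) := by
    rw [← Real.rpow_add_one hP.ne']; congr 1; ring
  rw [this]
  nlinarith [Real.rpow_nonneg hP.le (r - 2), sq_nonneg (s₁ - s₂)]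

theorem le_mul_rpow_half {L s₁ s₂ a : ℝ} (hL : 0 ≤ L) (h₁ : 0 ≤ s₁) (h₂ : 0 ≤ s₂)
    (ha₁ : a ≤ L * s₁) (ha₂ : a ≤ L * s₂) : a ≤ L * (s₁ * s₂) ^ (1 / 2 : ℝ) := by
  rw [← Real.sqrt_eq_rpow]
  rcases le_total s₁ s₂ with h | h
  · exact ha₁.trans (mul_le_mul_of_nonneg_left (Real.le_sqrt_of_sq_le (by nlinarith)) hL)
  · exact ha₂.trans (mul_le_mul_of_nonneg_left (Real.le_sqrt_of_sq_le (by nlinarith)) hL)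

theorem two_mul_rpow_div_two_le {β s₁ s₂ a K : ℝ} (hβ : 0 < β) (hβ1 : β ≤ 1) (hK : 0 ≤ K)
    (h₁ : 0 ≤ s₁) (h₂ : 0 ≤ s₂) (ha₁ : a ≤ 2 * (K * (2 * s₁) ^ β))
    (ha₂ : a ≤ 2 * (K * (2 * s₂) ^ β)) : a ≤ 4 * (K * (s₁ * s₂) ^ (β / 2)) := by
  have key : ∀ {s t : ℝ}, 0 ≤ s → s ≤ t → a ≤ 2 * (K * (2 * s) ^ β) →
      a ≤ 4 * (K * (s * t) ^ (β / 2)) := by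
    intro s t hs hst ha
    have e1 : (2 * s) ^ β ≤ 2 * s ^ β := by
      rw [Real.mul_rpow (by norm_num) hs]
      refine mul_le_mul_of_nonneg_right ?_ (by positivity)
      calc (2 : ℝ) ^ β ≤ 2 ^ (1 : ℝ) := Real.rpow_le_rpow_of_exponent_le (by norm_num) hβ1
        _ = 2 := Real.rpow_one 2
    have e2 : s ^ β ≤ (s * t) ^ (β / 2) := by
      calc s ^ β = (s ^ 2) ^ (β / 2) := by
            rw [← Real.rpow_natCast, ← Real.rpow_mul hs]; congr 1; push_cast; ring
        _ ≤ (s * t) ^ (β / 2) := by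
            refine Real.rpow_le_rpow (by positivity) ?_ (by positivity)
            nlinarith
    have e3 := mul_le_mul_of_nonneg_left (e1.trans (mul_le_mul_of_nonneg_left e2 zero_le_two)) hK
    linarith
  rcases le_total s₁ s₂ with h | h
  · exact key h₁ h ha₁
  · rw [mul_comm s₁]; exact key h₂ h ha₂

/-- Interior estimate for the mixed second derivatives of a solution of the Poisson equation with
Hölder continuous right-hand side. -/
theorem fderiv_fderiv_apply_add_le [FiniteDimensional ℝ E] {v : E → ℝ} {x₀ e e' : E}
    {d L K β : ℝ} (hd : 0 < d) (he : ‖e‖ = 1) (he' : ‖e'‖ = 1) (hee : inner ℝ e e' = 0)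
    (hβ : 0 < β) (hβ1 : β ≤ 1) (hK : 0 < K)
    (hv : ∀ x ∈ closedBall x₀ d, ContDiffAt ℝ 2 v x)
    (hL : ∀ x ∈ closedBall x₀ d, ‖fderiv ℝ v x‖ ≤ L)
    (hΔ : ∀ x ∈ closedBall x₀ d, ∀ y ∈ closedBall x₀ d, |Δ v x - Δ v y| ≤ K * ‖x - y‖ ^ β) :
    fderiv ℝ (fderiv ℝ v) x₀ e e' + fderiv ℝ (fderiv ℝ v) x₀ e' e ≤
      2 * ((2 * Module.finrank ℝ E + 6) * L / d + K * d ^ β / β) := by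
  set n : ℝ := ((Module.finrank ℝ E : ℕ) : ℝ) with hn
  have hx₀ : x₀ ∈ closedBall x₀ d := mem_closedBall_self hd.le
  have hL0 : 0 ≤ L := (norm_nonneg _).trans (hL _ hx₀)
  have hn0 : 0 ≤ n := by rw [hn]; positivity
  let b := stdOrthonormalBasis ℝ E
  let I := LinearIsometryEquiv.refl ℝ E
  let R₁ := hyperRefl e
  let R₂ := hyperRefl e'
  let R₃ := R₂.trans R₁
  have hee' : inner ℝ e' e = 0 := by rw [real_inner_comm]; exact hee
  have hself : inner ℝ e e = 1 := by rw [real_inner_self_eq_norm_sq, he]; norm_num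
  have hself' : inner ℝ e' e' = 1 := by rw [real_inner_self_eq_norm_sq, he']; norm_num
  have hI : ∀ z, I z = z := fun _ => rfl
  have hR₁ : ∀ z, R₁ z = z - (2 * inner ℝ e z) • e := hyperRefl_apply he
  have hR₂ : ∀ z, R₂ z = z - (2 * inner ℝ e' z) • e' := hyperRefl_apply he'
  have hR₃ : ∀ z, R₃ z = z - (2 * inner ℝ e' z) • e' - (2 * inner ℝ e z) • e := by
    intro z
    show R₁ (R₂ z) = _
    rw [hR₁, hR₂, inner_sub_right, inner_smul_right, hee]
    simp
  have hball : ∀ (T : E ≃ₗᵢ[ℝ] E) {z : E}, ‖z‖ ≤ d → x₀ + T z ∈ closedBall x₀ d := by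
    intro T z hz; simpa using hz
  have hdist : ∀ (T T' : E ≃ₗᵢ[ℝ] E) (z : E), x₀ + T z - (x₀ + T' z) = T z - T' z :=
    fun T T' z => by abel
  have hnorm : ∀ (s : ℝ) (w : E), 0 ≤ s → ‖w‖ = 1 → ‖(2 * s) • w‖ = 2 * s := by
    intro s w hs hw
    rw [norm_smul, hw, mul_one, Real.norm_of_nonneg (by positivity)]
  have hlip : ∀ x ∈ closedBall x₀ d, ∀ y ∈ closedBall x₀ d, v x - v y ≤ L * ‖x - y‖ := by
    intro x hx y hy
    refine (le_abs_self _).trans ?_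
    rw [← Real.norm_eq_abs]
    exact (convex_closedBall x₀ d).norm_image_sub_le_of_norm_fderiv_le
      (fun z hz => (hv z hz).differentiableAt (by simp)) hL hy hx
  let P : E → ℝ := fun z => inner ℝ e z * inner ℝ e' z
  let φ : E → ℝ := fun z =>
    1 / 4 * (((v (x₀ + I z) - v (x₀ + R₁ z)) - v (x₀ + R₂ z)) + v (x₀ + R₃ z))
  let k : ℝ := 2 * (n + 2)
  let B : E → ℝ := fun z => L / d ^ 2 * (P z ^ (1 / 2 : ℝ) * ‖z‖ ^ 2
    + k * (d * P z - P z ^ (3 / 2 : ℝ))) + K / β * (d ^ β * P z - P z ^ (1 + β / 2))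
  have c1 : ∀ w : E, Continuous fun z : E => inner ℝ w z := fun w => by fun_prop
  have c2 : Continuous fun z : E => ‖z‖ := continuous_norm
  have dist₁ : ∀ {z}, 0 ≤ inner ℝ e z →
      ‖I z - R₁ z‖ = 2 * inner ℝ e z ∧ ‖R₃ z - R₂ z‖ = 2 * inner ℝ e z := by
    intro z hz
    rw [hI, hR₁, hR₂, hR₃]
    constructor
    · rw [sub_sub_cancel, hnorm _ _ hz he]
    · rw [sub_sub_cancel_left, norm_neg, hnorm _ _ hz he]
  have dist₂ : ∀ {z}, 0 ≤ inner ℝ e' z →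
      ‖I z - R₂ z‖ = 2 * inner ℝ e' z ∧ ‖R₃ z - R₁ z‖ = 2 * inner ℝ e' z := by
    intro z hz
    rw [hI, hR₁, hR₂, hR₃]
    constructor
    · rw [sub_sub_cancel, hnorm _ _ hz he']
    · rw [show z - (2 * inner ℝ e' z) • e' - (2 * inner ℝ e z) • e - (z - (2 * inner ℝ e z) • e)
        = -((2 * inner ℝ e' z) • e') by abel, norm_neg, hnorm _ _ hz he']
  have hφ₁ : ∀ {z}, 0 ≤ inner ℝ e z → ‖z‖ ≤ d → φ z ≤ L * inner ℝ e z := by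
    intro z hz hzd
    have h1 := hlip _ (hball I hzd) _ (hball R₁ hzd)
    have h2 := hlip _ (hball R₃ hzd) _ (hball R₂ hzd)
    rw [hdist, (dist₁ hz).1] at h1
    rw [hdist, (dist₁ hz).2] at h2
    simp only [φ]
    linarith
  have hφ₂ : ∀ {z}, 0 ≤ inner ℝ e' z → ‖z‖ ≤ d → φ z ≤ L * inner ℝ e' z := by
    intro z hz hzd
    have h1 := hlip _ (hball I hzd) _ (hball R₂ hzd)
    have h2 := hlip _ (hball R₃ hzd) _ (hball R₁ hzd)
    rw [hdist, (dist₂ hz).1] at h1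
    rw [hdist, (dist₂ hz).2] at h2
    simp only [φ]
    linarith
  have key : ∀ z ∈ {z : E | (0 ≤ inner ℝ e z ∧ 0 ≤ inner ℝ e' z) ∧ ‖z‖ ≤ d}, φ z - B z ≤ 0 := by
    intro z hz
    refine nonpos_of_forall_not_isLocalMax
      (S := {z : E | (0 < inner ℝ e z ∧ 0 < inner ℝ e' z) ∧ ‖z‖ < d}) (f := fun z => φ z - B z)
      ?_ ?_ ?_ ?_ ?_ ?_ hz
    · refine (isCompact_closedBall (0 : E) d).of_isClosed_subset ?_ fun z hz => by simpa using hz.2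
      exact ((isClosed_le continuous_const (c1 e)).inter
        (isClosed_le continuous_const (c1 e'))).inter (isClosed_le c2 continuous_const)
    · exact ((isOpen_lt continuous_const (c1 e)).inter
        (isOpen_lt continuous_const (c1 e'))).inter (isOpen_lt c2 continuous_const)
    · exact fun z hz => ⟨⟨hz.1.1.le, hz.1.2.le⟩, hz.2.le⟩
    · have hc : ∀ T : E ≃ₗᵢ[ℝ] E, ContinuousOn (fun z => v (x₀ + T z))
          {z : E | (0 ≤ inner ℝ e z ∧ 0 ≤ inner ℝ e' z) ∧ ‖z‖ ≤ d} := fun T z hz =>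
        ContinuousAt.continuousWithinAt (ContinuousAt.comp (f := fun z => x₀ + T z)
          (hv _ (hball T hz.2)).continuousAt (by fun_prop))
      have hr : ∀ s : ℝ, 0 ≤ s → Continuous fun z => P z ^ s := fun s hs =>
        ((c1 e).mul (c1 e')).rpow_const fun _ => Or.inr hs
      refine (continuousOn_const.mul ((((hc I).sub (hc R₁)).sub (hc R₂)).add (hc R₃))).sub
        (Continuous.continuousOn ?_)
      have h1 := hr (1 / 2) (by norm_num)
      have h2 := hr (3 / 2) (by norm_num)
      have h3 := hr (1 + β / 2) (by positivity)
      have h4 : Continuous P := (c1 e).mul (c1 e')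
      fun_prop
    · intro z hz
      have hP : 0 < inner ℝ e z * inner ℝ e' z := mul_pos hz.1.1 hz.1.2
      have hp := hasLapJet_inner_mul_inner b e e' z
      obtain ⟨l, hl, hle⟩ := hasLapJet_rpow_half_mul_norm_sq b he he' hee hP
      have hlap : ∀ T : E ≃ₗᵢ[ℝ] E, HasLapJet b (fun y => v (x₀ + T y)) z (Δ v (x₀ + T z)) :=
        fun T => (hv _ (hball T hz.2.le)).hasLapJet_comp b T
      refine (((((hlap I).sub (hlap R₁)).sub (hlap R₂)).add (hlap R₃)).const_mul (1 / 4)).sub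
        (((hl.add (((hp.const_mul d).sub (hasLapJet_rpow b he he' hee hP (3 / 2))).const_mul
          k)).const_mul (L / d ^ 2)).add (((hp.const_mul (d ^ β)).sub
          (hasLapJet_rpow b he he' hee hP (1 + β / 2))).const_mul (K / β))) |>.not_isLocalMax ?_
      have hΔ' : ∀ T T' : E ≃ₗᵢ[ℝ] E, Δ v (x₀ + T' z) - Δ v (x₀ + T z) ≤ K * ‖T z - T' z‖ ^ β := by
        intro T T'
        have := (abs_le.1 (hΔ _ (hball T hz.2.le) _ (hball T' hz.2.le))).1
        rw [hdist] at this
        linarith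
      have h1 := two_mul_rpow_div_two_le hβ hβ1 hK.le hz.1.1.le hz.1.2.le
        (a := Δ v (x₀ + R₁ z) - Δ v (x₀ + I z) + (Δ v (x₀ + R₂ z) - Δ v (x₀ + R₃ z)))
        (by
          have h1 := hΔ' I R₁
          have h2 := hΔ' R₃ R₂
          rw [(dist₁ hz.1.1.le).1] at h1
          rw [(dist₁ hz.1.1.le).2] at h2
          linarith)
        (by
          have h1 := hΔ' I R₂
          have h2 := hΔ' R₃ R₁
          rw [(dist₂ hz.1.2.le).1] at h1
          rw [(dist₂ hz.1.2.le).2] at h2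
          linarith)
      rw [Fintype.card_fin, ← hn] at hle
      rw [hee]
      have h2 := two_mul_rpow_le_sq_add_sq_mul_rpow hz.1.1 hz.1.2 (3 / 2)
      have h3 := two_mul_rpow_le_sq_add_sq_mul_rpow hz.1.1 hz.1.2 (1 + β / 2)
      rw [show (3 / 2 - 1 : ℝ) = 1 / 2 by norm_num] at h2
      rw [show 1 + β / 2 - 1 = β / 2 by ring] at h3
      have hP1 : 0 ≤ (inner ℝ e z * inner ℝ e' z) ^ (1 / 2 : ℝ) := Real.rpow_nonneg hP.le _
      have hP2 : 0 < (inner ℝ e z * inner ℝ e' z) ^ (β / 2) := Real.rpow_pos_of_pos hP _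
      set p := (inner ℝ e z * inner ℝ e' z) ^ (1 / 2 : ℝ)
      set r := (inner ℝ e z * inner ℝ e' z) ^ (β / 2)
      set A := (inner ℝ e z * inner ℝ e' z) ^ (3 / 2 - 2 : ℝ) * (inner ℝ e z ^ 2 + inner ℝ e' z ^ 2)
        with hA
      set A' := (inner ℝ e z * inner ℝ e' z) ^ (1 + β / 2 - 2 : ℝ)
        * (inner ℝ e z ^ 2 + inner ℝ e' z ^ 2) with hA'
      have i1 : L / d ^ 2 * (l + k * (d * (2 * 0) - 3 / 2 * (3 / 2 - 1) * A)) ≤ 0 := by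
        refine mul_nonpos_of_nonneg_of_nonpos (by positivity) ?_
        simp only [k]
        nlinarith
      have i2 : K / β * (d ^ β * (2 * 0) - (1 + β / 2) * (1 + β / 2 - 1) * A')
          ≤ - (K * ((1 + β / 2) * r)) := by
        have : (1 + β / 2) * (1 + β / 2 - 1) * (2 * r) ≤ (1 + β / 2) * (1 + β / 2 - 1) * A' :=
          mul_le_mul_of_nonneg_left h3 (by ring_nf; positivity)
        calc _ ≤ K / β * (d ^ β * (2 * 0) - (1 + β / 2) * (1 + β / 2 - 1) * (2 * r)) :=
              mul_le_mul_of_nonneg_left (by linarith) (by positivity)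
          _ = _ := by field_simp; ring
      have i3 : 0 < K * (β / 2 * r) := by positivity
      simp only [mul_assoc] at i1 i2 ⊢
      rw [← hA, ← hA']
      linarith
    · intro z hz hzS
      have hle : inner ℝ e z ≤ ‖z‖ := by simpa [he] using real_inner_le_norm e z
      have hle' : inner ℝ e' z ≤ ‖z‖ := by simpa [he'] using real_inner_le_norm e' z
      obtain ⟨⟨hz1, hz2⟩, hz3⟩ := hz
      by_cases hz0 : P z = 0
      · have hφ0 : φ z ≤ 0 := by
          rcases mul_eq_zero.1 hz0 with h | h
          · simpa [h] using hφ₁ hz1 hz3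
          · simpa [h] using hφ₂ hz2 hz3
        have hB0 : B z = 0 := by
          simp only [B, hz0]
          rw [Real.zero_rpow (by norm_num), Real.zero_rpow (by norm_num),
            Real.zero_rpow (by positivity)]
          ring
        linarith
      · have hs1 : inner ℝ e z ≠ 0 := left_ne_zero_of_mul hz0
        have hs2 : inner ℝ e' z ≠ 0 := right_ne_zero_of_mul hz0
        have hP : 0 < P z := mul_pos (lt_of_le_of_ne hz1 hs1.symm) (lt_of_le_of_ne hz2 hs2.symm)
        have hzd : ‖z‖ = d := by
          by_contra hne
          exact hzS ⟨⟨lt_of_le_of_ne hz1 hs1.symm, lt_of_le_of_ne hz2 hs2.symm⟩,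
            lt_of_le_of_ne hz3 hne⟩
        have hPd : P z ≤ d ^ 2 := by
          simp only [P]; nlinarith
        have hpow : ∀ s : ℝ, 0 ≤ s → P z ^ (1 + s) ≤ d ^ (2 * s) * P z := by
          intro s hs
          rw [Real.rpow_add hP, Real.rpow_one, mul_comm]
          refine mul_le_mul_of_nonneg_right ?_ hP.le
          rw [Real.rpow_mul hd.le, Real.rpow_two]
          exact Real.rpow_le_rpow hP.le hPd hs
        have q1 := hpow (1 / 2) (by norm_num)
        have q2 := hpow (β / 2) (by positivity)
        rw [show (1 + 1 / 2 : ℝ) = 3 / 2 by norm_num, show (2 * (1 / 2) : ℝ) = 1 by norm_num,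
          Real.rpow_one] at q1
        rw [show 2 * (β / 2) = β by ring] at q2
        have q3 : φ z ≤ L * P z ^ (1 / 2 : ℝ) :=
          le_mul_rpow_half hL0 hz1 hz2 (hφ₁ hz1 hz3) (hφ₂ hz2 hz3)
        have q4 : L / d ^ 2 * (P z ^ (1 / 2 : ℝ) * ‖z‖ ^ 2) = L * P z ^ (1 / 2 : ℝ) := by
          rw [hzd]; field_simp
        have q5 : 0 ≤ L / d ^ 2 * (k * (d * P z - P z ^ (3 / 2 : ℝ))) :=
          mul_nonneg (by positivity) (mul_nonneg (by positivity) (by linarith))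
        have q6 : 0 ≤ K / β * (d ^ β * P z - P z ^ (1 + β / 2)) :=
          mul_nonneg (by positivity) (by linarith)
        simp only [B]
        linarith
  set C := (2 * n + 6) * L / d + K * d ^ β / β with hC
  have h0 : ∀ T : E ≃ₗᵢ[ℝ] E, ContDiffAt ℝ 2 v (x₀ + T 0) := fun T =>
    hv _ (hball T (by simpa using hd.le))
  set ζ := e + e' with hζ
  have hline : HasJet (fun t : ℝ => φ (0 + t • ζ) - C * ((0 + t * 1) * (0 + t * 1))) _ _ _ :=
    ((((((h0 I).hasJet_comp I ζ).sub ((h0 R₁).hasJet_comp R₁ ζ)).sub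
    ((h0 R₂).hasJet_comp R₂ ζ)).add ((h0 R₃).hasJet_comp R₃ ζ)).const_mul (1 / 4)).sub
      (((HasJet.affine 0 1).mul (HasJet.affine 0 1)).const_mul C)
  have iζ : inner ℝ e ζ = 1 := by rw [hζ, inner_add_right, hself, hee]; norm_num
  have iζ' : inner ℝ e' ζ = 1 := by rw [hζ, inner_add_right, hself', hee']; norm_num
  have hζ1 : R₁ ζ = e' - e := by rw [hR₁, iζ, hζ]; module
  have hζ2 : R₂ ζ = e - e' := by rw [hR₂, iζ', hζ]; module
  have hζ3 : R₃ ζ = -(e + e') := by rw [hR₃, iζ, iζ', hζ]; module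
  have hζn : ‖ζ‖ ^ 2 = 2 := by
    rw [← real_inner_self_eq_norm_sq]
    nth_rewrite 1 [hζ]
    rw [inner_add_left, iζ, iζ']
    norm_num
  have hpos : ∀ t : ℝ, 0 ≤ t → t ≤ d / 2 → φ (t • ζ) - C * (t * t) ≤ 0 := by
    intro t ht htd
    have hnz : ‖t • ζ‖ ^ 2 = 2 * t ^ 2 := by
      rw [norm_smul, mul_pow, hζn, Real.norm_eq_abs, sq_abs]
      ring
    have hnd : ‖t • ζ‖ ≤ d := by
      refine abs_le_of_sq_le_sq' ?_ hd.le |>.2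
      rw [hnz]; nlinarith
    have h1 := key (t • ζ) ⟨⟨by rw [inner_smul_right, iζ]; linarith,
      by rw [inner_smul_right, iζ']; linarith⟩, hnd⟩
    have hPt : P (t • ζ) = t ^ 2 := by simp only [P, inner_smul_right, iζ, iζ']; ring
    have hh : (t ^ 2) ^ (1 / 2 : ℝ) = t := by
      rw [← Real.sqrt_eq_rpow, Real.sqrt_sq ht]
    simp only [B, hPt, hnz, hh] at h1
    have q1 : 0 ≤ (t ^ 2) ^ (3 / 2 : ℝ) := by positivity
    have q2 : 0 ≤ (t ^ 2) ^ (1 + β / 2 : ℝ) := by positivity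
    have q3 : L / d ^ 2 * (t * (2 * t ^ 2) + k * (d * t ^ 2 - (t ^ 2) ^ (3 / 2 : ℝ)))
        ≤ (2 * n + 6) * L / d * (t * t) := by
      calc _ ≤ L / d ^ 2 * (d * (2 * t ^ 2) + k * (d * t ^ 2)) := by
            refine mul_le_mul_of_nonneg_left (add_le_add ?_ ?_) (by positivity)
            · exact mul_le_mul_of_nonneg_right (by linarith) (by positivity)
            · exact mul_le_mul_of_nonneg_left (by linarith) (by positivity)
        _ = _ := by simp only [k]; field_simp; ring
    have q4 : K / β * (d ^ β * t ^ 2 - (t ^ 2) ^ (1 + β / 2)) ≤ K * d ^ β / β * (t * t) := by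
      calc _ ≤ K / β * (d ^ β * t ^ 2) :=
            mul_le_mul_of_nonneg_left (by linarith) (by positivity)
        _ = _ := by ring
    rw [hC, add_mul]
    linarith
  have hev : ∀ t : ℝ, φ ((-t) • ζ) = φ (t • ζ) := by
    intro t
    simp only [φ, map_smul, hζ1, hζ2, hζ3, hI]
    rw [show (-t) • (e' - e) = t • (e - e') by module, show (-t) • (e - e') = t • (e' - e) by module,
      show (-t) • (-(e + e')) = t • ζ by rw [hζ]; module,
      show (-t) • ζ = t • (-(e + e')) by rw [hζ]; module]
    ring
  have hmax : IsLocalMax (fun t : ℝ => φ (0 + t • ζ) - C * ((0 + t * 1) * (0 + t * 1))) 0 := by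
    have hz : φ (0 + (0 : ℝ) • ζ) - C * ((0 + 0 * 1) * (0 + 0 * 1)) = 0 := by simp [φ]
    have hd2 : 0 < d / 2 := by positivity
    filter_upwards [Ioo_mem_nhds (neg_lt_zero.2 hd2) hd2] with t ht
    rw [hz]
    simp only [zero_add, mul_one]
    rcases le_total 0 t with h | h
    · exact hpos t h ht.2.le
    · have := hpos (-t) (by linarith) (by linarith [ht.1])
      rw [hev, neg_mul_neg] at this
      exact this
  have hfin := (hline.eq_zero_and_nonpos_of_isLocalMax hmax).2
  simp only [hζ1, hζ2, hζ3, hI, map_zero, add_zero] at hfin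
  simp only [hζ, map_add, map_sub, map_neg, add_apply, sub_apply, neg_apply] at hfin
  linarith

theorem norm_le_of_forall_basis {ι : Type*} [Fintype ι] (b : OrthonormalBasis ι ℝ E)
    (H : E →L[ℝ] E →L[ℝ] ℝ) {B : ℝ} (hB : 0 ≤ B) (h : ∀ i j, |H (b i) (b j)| ≤ B) :
    ‖H‖ ≤ (Fintype.card ι : ℝ) ^ 2 * B := by
  refine H.opNorm_le_bound₂ (by positivity) fun x y => ?_
  have hx : ∀ x i, |b.repr x i| ≤ ‖x‖ := by
    intro x i
    rw [b.repr_apply_apply]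
    simpa using abs_real_inner_le_norm (b i) x
  have hxy : H x y = ∑ i, ∑ j, b.repr x i * (b.repr y j * H (b i) (b j)) := by
    conv_lhs => rw [← b.sum_repr x, ← b.sum_repr y]
    simp [Finset.mul_sum]
    rw [Finset.sum_comm]
    refine Finset.sum_congr rfl fun i _ => Finset.sum_congr rfl fun j _ => by ring
  rw [hxy]
  calc ‖∑ i, ∑ j, b.repr x i * (b.repr y j * H (b i) (b j))‖
      ≤ ∑ i : ι, ∑ j : ι, ‖x‖ * (‖y‖ * B) := by
        refine (norm_sum_le _ _).trans (Finset.sum_le_sum fun i _ => ?_)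
        refine (norm_sum_le _ _).trans (Finset.sum_le_sum fun j _ => ?_)
        rw [norm_mul, norm_mul]
        exact mul_le_mul (hx _ _) (mul_le_mul (hx _ _) (h _ _) (by positivity) (by positivity))
          (by positivity) (by positivity)
    _ = _ := by simp; ring

theorem norm_fderiv_fderiv_le [FiniteDimensional ℝ E] [Nontrivial E] {v : E → ℝ} {x₀ : E}
    {d L K β : ℝ} (hd : 0 < d) (hK : 0 < K) (hβ : 0 < β) (hβ1 : β ≤ 1)
    (hv : ∀ x ∈ closedBall x₀ d, ContDiffAt ℝ 2 v x)
    (hL : ∀ x ∈ closedBall x₀ d, ‖fderiv ℝ v x‖ ≤ L)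
    (hF : ∀ x ∈ closedBall x₀ d, ∀ y ∈ closedBall x₀ d, |Δ v x - Δ v y| ≤ K * ‖x - y‖ ^ β) :
    ‖fderiv ℝ (fderiv ℝ v) x₀‖ ≤ (Module.finrank ℝ E : ℝ) ^ 2 *
      (2 * ((2 * Module.finrank ℝ E + 6) * L / d + K * d ^ β / β) + |Δ v x₀|) := by
  set n := Module.finrank ℝ E with hn
  set H := fderiv ℝ (fderiv ℝ v) x₀ with hH
  set B := (2 * n + 6) * L / d + K * d ^ β / β with hBdef
  have hL0 : 0 ≤ L := (norm_nonneg _).trans (hL x₀ (mem_closedBall_self hd.le))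
  have hB0 : 0 ≤ B := by positivity
  have hsymm : ∀ x y, H x y = H y x := fun x y =>
    ((hv x₀ (mem_closedBall_self hd.le)).isSymmSndFDerivAt (by simp)) x y
  have key : ∀ e e' : E, ‖e‖ = 1 → ‖e'‖ = 1 → inner ℝ e e' = 0 → |H e e'| ≤ B := by
    intro e e' he he' hee
    have h1 := fderiv_fderiv_apply_add_le hd he he' hee hβ hβ1 hK hv hL hF
    have h2 := fderiv_fderiv_apply_add_le hd (e := -e) (by simpa using he) he' (by simpa using hee)
      hβ hβ1 hK hv hL hF
    rw [← hH, ← hn, ← hBdef] at h1 h2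
    simp only [map_neg, neg_apply] at h2
    rw [abs_le]
    constructor <;> linarith [hsymm e e']
  let b := stdOrthonormalBasis ℝ E
  have hdiff : ∀ i j, |H (b i) (b i) - H (b j) (b j)| ≤ 2 * B := by
    intro i j
    by_cases hij : i = j
    · subst hij; simpa using hB0
    have hi : inner ℝ (b i) (b i) = (1 : ℝ) := by simp
    have hj : inner ℝ (b j) (b j) = (1 : ℝ) := by simp
    have hbij : inner ℝ (b i) (b j) = (0 : ℝ) := b.inner_eq_zero hij
    have hbji : inner ℝ (b j) (b i) = (0 : ℝ) := b.inner_eq_zero (Ne.symm hij)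
    set r := (√2)⁻¹ with hr
    have hrr : r * r = 1 / 2 := by
      rw [hr, ← mul_inv, Real.mul_self_sqrt (by norm_num)]; norm_num
    have hns : ∀ s : ℝ, s = 1 ∨ s = -1 → ‖r • (b i + s • b j)‖ = 1 := by
      intro s hs
      rw [← sq_eq_sq₀ (norm_nonneg _) zero_le_one, ← real_inner_self_eq_norm_sq]
      simp only [inner_smul_left, inner_smul_right, inner_add_left, inner_add_right, hi, hj, hbij,
        hbji, RCLike.conj_to_real]
      rcases hs with rfl | rfl <;> linarith
    have := key (r • (b i + (1 : ℝ) • b j)) (r • (b i + (-1 : ℝ) • b j)) (hns _ (.inl rfl))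
      (hns _ (.inr rfl)) (by
        simp only [inner_smul_left, inner_smul_right, inner_add_left, inner_add_right, hi, hj, hbij,
        hbji, RCLike.conj_to_real]
        ring)
    simp only [map_smul, map_add, smul_apply, add_apply, smul_eq_mul] at this
    rw [hsymm (b j) (b i)] at this
    have e : H (b i) (b i) - H (b j) (b j) = 2 * (r * (r * (H (b i) (b i) + 1 * H (b i) (b j)
       + -1 * (H (b i) (b j) + 1 * H (b j) (b j))))) := by
      linear_combination (-2) * (H (b i) (b i) - H (b j) (b j)) * hrr
    rw [e, abs_mul, abs_two]
    refine mul_le_mul_of_nonneg_left ((le_of_eq ?_).trans this) zero_le_two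
    congr 1
    ring
  have hn0 : (0 : ℝ) < n := by exact_mod_cast Module.finrank_pos
  have hn1 : (1 : ℝ) ≤ n := by exact_mod_cast (Module.finrank_pos : 0 < n)
  have hdiag : ∀ i, |H (b i) (b i)| ≤ 2 * B + |Δ v x₀| := by
    intro i
    have e : n * H (b i) (b i) = Δ v x₀ + ∑ j, (H (b i) (b i) - H (b j) (b j)) := by
      rw [laplacian_eq_sum_fderiv_fderiv b, Finset.sum_sub_distrib]
      simp [hH, hn]
    have h2 : |n * H (b i) (b i)| ≤ |Δ v x₀| + n * (2 * B) := by
      rw [e]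
      refine (abs_add_le _ _).trans (add_le_add le_rfl ?_)
      refine (Finset.abs_sum_le_sum_abs _ _).trans ((Finset.sum_le_sum fun j _ => hdiff i j).trans ?_)
      simp [hn]
    rw [abs_mul, abs_of_pos hn0] at h2
    have h3 : n * |H (b i) (b i)| ≤ n * (2 * B + |Δ v x₀|) := by
      nlinarith [abs_nonneg (Δ v x₀)]
    exact le_of_mul_le_mul_left h3 hn0
  have := norm_le_of_forall_basis b H (B := 2 * B + |Δ v x₀|) (by positivity) (fun i j => by
    by_cases hij : i = j
    · subst hij; exact hdiag i
    · have := key (b i) (b j) (by simp) (by simp) (b.inner_eq_zero hij)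
      linarith [abs_nonneg (Δ v x₀)])
  simpa using this

theorem laplacian_comp_add_right [FiniteDimensional ℝ E] (w : E → ℝ) (h x : E) :
    Δ (fun z => w (z + h)) x = Δ w (x + h) := by
  have e : fderiv ℝ (fun z => w (z + h)) = fun z => fderiv ℝ w (z + h) :=
    funext fun z => fderiv_comp_add_right h
  rw [laplacian_eq_sum_fderiv_fderiv (stdOrthonormalBasis ℝ E),
    laplacian_eq_sum_fderiv_fderiv (stdOrthonormalBasis ℝ E), e, fderiv_comp_add_right]

theorem norm_fderiv_add_sub_le [FiniteDimensional ℝ E] {w : E → ℝ} {x₀ h : E} {L F : ℝ}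
    (hh : ‖h‖ ≤ 1) (hw : ∀ z ∈ closedBall x₀ 2, ContDiffAt ℝ 2 w z)
    (hL : ∀ z ∈ closedBall x₀ 2, ‖fderiv ℝ w z‖ ≤ L) (hF : ∀ z ∈ closedBall x₀ 2, |Δ w z| ≤ F) :
    ‖fderiv ℝ w (x₀ + h) - fderiv ℝ w x₀‖ ≤ (Module.finrank ℝ E * L + F + 1) * √‖h‖ := by
  have h2 : x₀ ∈ closedBall x₀ 2 := mem_closedBall_self zero_le_two
  have hL0 : 0 ≤ L := (norm_nonneg _).trans (hL x₀ h2)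
  have hF0 : 0 ≤ F := (abs_nonneg _).trans (hF x₀ h2)
  rcases eq_or_ne h 0 with rfl | hne
  · simp
  have hpos : 0 < ‖h‖ := norm_pos_iff.2 hne
  have hd : 0 < √‖h‖ := Real.sqrt_pos.2 hpos
  have hd1 : √‖h‖ ≤ 1 := Real.sqrt_le_one.2 hh
  have hdd : √‖h‖ * √‖h‖ = ‖h‖ := Real.mul_self_sqrt hpos.le
  have hm : ∀ z ∈ closedBall x₀ √‖h‖, z ∈ closedBall x₀ 2 ∧ z + h ∈ closedBall x₀ 2 := by
    intro z hz
    rw [mem_closedBall, dist_eq_norm] at hz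
    constructor
    · rw [mem_closedBall, dist_eq_norm]; linarith
    · rw [mem_closedBall, dist_eq_norm, add_sub_right_comm]
      linarith [norm_add_le (z - x₀) h]
  have hc : ∀ z ∈ closedBall x₀ √‖h‖, ContDiffAt ℝ 2 (fun z => w (z + h)) z := fun z hz =>
    (hw _ (hm z hz).2).comp z (contDiffAt_id.add contDiffAt_const)
  have hfd : ∀ z ∈ closedBall x₀ √‖h‖,
      fderiv ℝ ((fun z => w (z + h)) - w) z = fderiv ℝ w (z + h) - fderiv ℝ w z := by
    intro z hz
    rw [fderiv_sub ((hc z hz).differentiableAt (by simp))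
      ((hw z (hm z hz).1).differentiableAt (by simp)), fderiv_comp_add_right]
  have key : ∀ e : E, ‖e‖ = 1 → (fderiv ℝ w (x₀ + h) - fderiv ℝ w x₀) e ≤
      (Module.finrank ℝ E * L + F + 1) * √‖h‖ := by
    intro e he
    have := fderiv_apply_le_of_laplacian_lt (v := (fun z => w (z + h)) - w) (M := L * ‖h‖)
      (F := 2 * F + 1) hd he (fun z hz => (hc z hz).sub (hw z (hm z hz).1)) (fun z hz => by
        have := (convex_closedBall x₀ 2).norm_image_sub_le_of_norm_fderiv_le
          (fun y hy => (hw y hy).differentiableAt (by simp)) hL (hm z hz).1 (hm z hz).2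
        simpa using this) (fun z hz => by
        rw [(hc z hz).laplacian_sub (hw z (hm z hz).1), laplacian_comp_add_right]
        have h1 := abs_le.1 (hF _ (hm z hz).1)
        have h2 := abs_le.1 (hF _ (hm z hz).2)
        rw [abs_lt]
        constructor <;> linarith)
    rw [hfd x₀ (mem_closedBall_self hd.le)] at this
    refine this.trans ?_
    have e1 : Module.finrank ℝ E * (L * ‖h‖) / √‖h‖ = Module.finrank ℝ E * L * √‖h‖ := by
      rw [div_eq_iff hd.ne']; linear_combination (-(Module.finrank ℝ E * L : ℝ)) * hdd
    rw [e1]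
    linarith
  refine ContinuousLinearMap.opNorm_le_of_unit_norm (by positivity) fun e he => ?_
  rw [Real.norm_eq_abs, abs_le]
  have h1 := key e he
  have h3 := key (-e) (by simpa using he)
  rw [map_neg] at h3
  constructor <;> linarith

theorem Ultrafilter.uniformCauchySeqOn {ι X G : Type*} [PseudoMetricSpace X]
    [NormedAddCommGroup G] [ProperSpace G] {𝒰 : Ultrafilter ι} {g : ι → X → G} {S : Set X}
    (hS : TotallyBounded S) (hb : ∀ x ∈ S, ∃ B, ∀ᶠ k in 𝒰, ‖g k x‖ ≤ B)
    (he : ∀ ε > 0, ∃ δ > 0, ∀ᶠ k in 𝒰, ∀ x ∈ S, ∀ y ∈ S, dist x y < δ → dist (g k x) (g k y) ≤ ε) :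
    UniformCauchySeqOn g 𝒰 S := by
  have hlim : ∀ x ∈ S, ∃ l, Tendsto (fun k => g k x) 𝒰 (𝓝 l) := by
    intro x hx
    obtain ⟨B, hB⟩ := hb x hx
    obtain ⟨l, -, hl⟩ := (isCompact_closedBall (0 : G) B).ultrafilter_le_nhds
      (𝒰.map fun k => g k x) (le_principal_iff.2 (Ultrafilter.mem_map.2 (hB.mono fun k hk => by simpa using hk)))
    exact ⟨l, hl⟩
  choose! l hl using hlim
  intro u hu
  obtain ⟨ε, hε, hεu⟩ := Metric.mem_uniformity_dist.1 hu
  obtain ⟨δ, hδ, hev⟩ := he (ε / 5) (by positivity)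
  obtain ⟨t, htS, htf, hcov⟩ := finite_approx_of_totallyBounded hS δ hδ
  have hev2 : ∀ᶠ k in (𝒰 : Filter ι), ∀ y ∈ t, dist (g k y) (l y) < ε / 5 :=
    (eventually_all_finite htf).2 fun y hy =>
      (hl y (htS hy)).eventually (ball_mem_nhds _ (by positivity))
  have hev3 := hev.and hev2
  filter_upwards [hev3.prod_mk hev3] with ⟨k, m⟩ ⟨⟨hk1, hk2⟩, hm1, hm2⟩ x hx
  refine hεu ?_
  obtain ⟨y, hy, hxy⟩ := mem_iUnion₂.1 (hcov hx)
  have a1 := hk1 x hx y (htS hy) hxy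
  have a2 := hm1 x hx y (htS hy) hxy
  have a3 := hk2 y hy
  have a4 := hm2 y hy
  have b1 := dist_triangle (g k x) (g k y) (l y)
  have b2 := dist_triangle_right (g k x) (g m x) (l y)
  have b3 := dist_triangle (g m x) (g m y) (l y)
  linarith

theorem exists_pos_forall_mul_rpow_le {K β ε : ℝ} (hβ : 0 < β) (hε : 0 < ε) :
    ∃ δ > 0, ∀ t, 0 ≤ t → t ≤ δ → K * t ^ β ≤ ε := by
  have h : ContinuousAt (fun t : ℝ => K * t ^ β) 0 :=
    (Real.continuousAt_rpow_const _ _ (.inr hβ.le)).const_mul K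
  obtain ⟨δ, hδ, hd⟩ := Metric.continuousAt_iff.1 h ε hε
  refine ⟨δ / 2, by positivity, fun t ht htd => ?_⟩
  have := hd (x := t) (by rw [Real.dist_0_eq_abs, abs_of_nonneg ht]; linarith)
  rw [Real.zero_rpow hβ.ne', mul_zero, Real.dist_0_eq_abs] at this
  exact (le_abs_self _).trans this.le

theorem exists_tendstoUniformlyOn_ball {E ι G : Type*} [NormedAddCommGroup E]
    [NormedAddCommGroup G] [CompleteSpace G]
    {𝒰 : Filter ι} [NeBot 𝒰] {g : ι → E → G} (hg : ∀ r, UniformCauchySeqOn g 𝒰 (ball 0 r)) :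
    ∃ l : E → G, (∀ x, Tendsto (fun k => g k x) 𝒰 (𝓝 (l x))) ∧
      ∀ r, TendstoUniformlyOn g l 𝒰 (ball 0 r) := by
  have : ∀ x, ∃ l, Tendsto (fun k => g k x) 𝒰 (𝓝 l) := fun x =>
    cauchy_map_iff_exists_tendsto.1 ((hg (‖x‖ + 1)).cauchy_map (by simp))
  choose l hl using this
  exact ⟨l, hl, fun r => (hg r).tendstoUniformlyOn_of_tendsto fun x _ => hl x⟩

theorem tendstoUniformlyOnFilter_of_ball {E ι G : Type*} [NormedAddCommGroup E]
    [NormedAddCommGroup G]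
    {𝒰 : Filter ι} {g : ι → E → G} {l : E → G} (hg : ∀ r, TendstoUniformlyOn g l 𝒰 (ball 0 r))
    (x : E) : TendstoUniformlyOnFilter g l 𝒰 (𝓝 x) := by
  refine (hg (‖x‖ + 1)).tendstoUniformlyOnFilter.mono_right (le_principal_iff.2 ?_)
  exact isOpen_ball.mem_nhds (by simp)

theorem exists_contDiff_limit [FiniteDimensional ℝ E] [Nontrivial E] {ι : Type*}
    {𝒰 : Ultrafilter ι} {w : ι → E → ℝ} {L F β : ℝ} (hβ : 0 < β) (hβ1 : β ≤ 1)
    (h0 : ∀ k, w k 0 = 0)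
    (hC : ∀ r, ∀ᶠ k in 𝒰, ∀ x ∈ ball (0 : E) r, ContDiffAt ℝ 2 (w k) x)
    (hL : ∀ r, ∀ᶠ k in 𝒰, ∀ x ∈ ball (0 : E) r, ‖fderiv ℝ (w k) x‖ ≤ L)
    (hF : ∀ r, ∀ᶠ k in 𝒰, ∀ x ∈ ball (0 : E) r, |Δ (w k) x| ≤ F)
    (hK : ∀ r, ∃ K > 0, ∀ᶠ k in 𝒰, ∀ x ∈ ball (0 : E) r, ∀ y ∈ ball (0 : E) r, ‖x - y‖ ≤ 1 →
      |Δ (w k) x - Δ (w k) y| ≤ K * ‖x - y‖ ^ β) :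
    ∃ W : E → ℝ, ContDiff ℝ 2 W ∧ ∀ x, Tendsto (fun k => w k x) 𝒰 (𝓝 (W x)) ∧
      Tendsto (fun k => fderiv ℝ (w k) x) 𝒰 (𝓝 (fderiv ℝ W x)) ∧
      Tendsto (fun k => Δ (w k) x) 𝒰 (𝓝 (Δ W x)) := by
  have : ProperSpace E := FiniteDimensional.proper ℝ E
  have : ProperSpace (E →L[ℝ] ℝ) := FiniteDimensional.proper ℝ _
  have hL0 : 0 ≤ L := by
    obtain ⟨k, hk⟩ := (hL 1).exists
    exact (norm_nonneg _).trans (hk 0 (mem_ball_self one_pos))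
  have hF0 : 0 ≤ F := by
    obtain ⟨k, hk⟩ := (hF 1).exists
    exact (abs_nonneg _).trans (hk 0 (mem_ball_self one_pos))
  have htb : ∀ r, TotallyBounded (ball (0 : E) r) := fun r =>
    (isCompact_closedBall (0 : E) r).totallyBounded.subset ball_subset_closedBall
  have U1 : ∀ r, UniformCauchySeqOn w 𝒰 (ball 0 r) := by
    intro r
    have hlip : ∀ᶠ k in (𝒰 : Filter ι), ∀ x ∈ ball (0 : E) r, ∀ y ∈ ball (0 : E) r,
        dist (w k x) (w k y) ≤ L * dist x y := by
      filter_upwards [hC r, hL r] with k h1 h2 x hx y hy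
      rw [dist_eq_norm, dist_eq_norm]
      exact (convex_ball (0 : E) r).norm_image_sub_le_of_norm_fderiv_le
        (fun y hy => (h1 y hy).differentiableAt (by simp)) h2 hy hx
    refine Ultrafilter.uniformCauchySeqOn (htb r) (fun x hx => ⟨L * dist x 0, ?_⟩) fun ε hε => ?_
    · filter_upwards [hlip] with k hk
      have := hk x hx 0 (mem_ball_self ((norm_nonneg x).trans_lt (by simpa using hx)))
      simpa [h0] using this
    · refine ⟨ε / (L + 1), by positivity, ?_⟩
      filter_upwards [hlip] with k hk x hx y hy hxy
      rw [lt_div_iff₀ (by positivity)] at hxy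
      linarith [hk x hx y hy, dist_nonneg (x := x) (y := y)]
  have hsub : ∀ {r : ℝ} {x : E} (d : ℝ), x ∈ ball (0 : E) r → closedBall x d ⊆ ball 0 (r + d) := by
    intro r x d hx z hz
    rw [mem_ball_zero_iff] at hx ⊢
    rw [mem_closedBall, dist_eq_norm] at hz
    have := norm_add_le (z - x) x
    rw [sub_add_cancel] at this
    linarith
  have U2 : ∀ r, UniformCauchySeqOn (fun k => fderiv ℝ (w k)) 𝒰 (ball 0 r) := by
    intro r
    refine Ultrafilter.uniformCauchySeqOn (htb r)
      (fun x hx => ⟨L, (hL r).mono fun k hk => hk x hx⟩) fun ε hε => ?_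
    obtain ⟨δ, hδ, hd⟩ := exists_pos_forall_mul_rpow_le
      (K := Module.finrank ℝ E * L + F + 1) (β := 1 / 2) (by norm_num) hε
    refine ⟨min δ 1, by positivity, ?_⟩
    filter_upwards [hC (r + 2), hL (r + 2), hF (r + 2)] with k h1 h2 h3 x hx y hy hxy
    rw [lt_min_iff] at hxy
    rw [dist_comm, dist_eq_norm] at hxy
    have := norm_fderiv_add_sub_le (h := y - x) hxy.2.le (fun z hz => h1 z (hsub 2 hx hz))
      (fun z hz => h2 z (hsub 2 hx hz)) (fun z hz => h3 z (hsub 2 hx hz))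
    rw [add_sub_cancel] at this
    rw [dist_comm, dist_eq_norm]
    refine this.trans ?_
    rw [Real.sqrt_eq_rpow]
    exact hd _ (norm_nonneg _) hxy.1.le
  have U3 : ∀ r, UniformCauchySeqOn (fun k => Δ (w k)) 𝒰 (ball 0 r) := by
    intro r
    obtain ⟨K, hK0, hKr⟩ := hK r
    refine Ultrafilter.uniformCauchySeqOn (htb r)
      (fun x hx => ⟨F, (hF r).mono fun k hk => hk x hx⟩) fun ε hε => ?_
    obtain ⟨δ, hδ, hd⟩ := exists_pos_forall_mul_rpow_le (K := K) hβ hε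
    refine ⟨min δ 1, by positivity, ?_⟩
    filter_upwards [hKr] with k h1 x hx y hy hxy
    rw [lt_min_iff, dist_eq_norm] at hxy
    exact (h1 x hx y hy hxy.2.le).trans (hd _ (norm_nonneg _) hxy.1.le)
  have U4 : ∀ r, UniformCauchySeqOn (fun k => fderiv ℝ (fderiv ℝ (w k))) 𝒰 (ball 0 r) := by
    intro r
    obtain ⟨K, hK0, hKr⟩ := hK (r + 1)
    intro u hu
    obtain ⟨ε, hε, hεu⟩ := (Metric.mem_uniformity_dist (α := E →L[ℝ] E →L[ℝ] ℝ)).1 hu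
    set n : ℝ := ((Module.finrank ℝ E : ℕ) : ℝ) with hn
    obtain ⟨δ, hδ, hd⟩ := exists_pos_forall_mul_rpow_le (K := n ^ 2 * (2 * (2 * K / β)))
      hβ (half_pos hε)
    obtain ⟨d, hd0, hdδ, hd1⟩ : ∃ d > 0, d ≤ δ ∧ d ≤ 1 / 2 :=
      ⟨min δ (1 / 2), by positivity, min_le_left _ _, min_le_right _ _⟩
    set A := n ^ 2 * (2 * ((2 * n + 6) / d) + 1) with hA
    have hA0 : 0 ≤ A := by positivity
    set γ := ε / (4 * (A + 1)) with hγ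
    have hγ0 : 0 < γ := by positivity
    have hγA : γ * A < ε / 2 := by
      rw [hγ, div_mul_eq_mul_div, div_lt_iff₀ (by positivity)]
      nlinarith
    have hsm := (hC (r + 1)).and hKr
    filter_upwards [hsm.prod_mk hsm, U2 (r + 1) _ (dist_mem_uniformity hγ0),
      U3 (r + 1) _ (dist_mem_uniformity hγ0)] with ⟨k, m⟩ ⟨⟨hk1, hk2⟩, hm1, hm2⟩ h2 h3 x hx
    refine hεu ?_
    have hs : closedBall x d ⊆ ball 0 (r + 1) :=
      (hsub d hx).trans (ball_subset_ball (by linarith))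
    have hΔ : ∀ y ∈ closedBall x d, Δ (w k - w m) y = Δ (w k) y - Δ (w m) y := fun y hy =>
      (hk1 y (hs hy)).laplacian_sub (hm1 y (hs hy))
    have hxx : x ∈ closedBall x d := mem_closedBall_self hd0.le
    have hfd : ∀ y ∈ closedBall x d,
        fderiv ℝ (w k - w m) y = fderiv ℝ (w k) y - fderiv ℝ (w m) y := fun y hy =>
      fderiv_sub ((hk1 y (hs hy)).differentiableAt (by simp))
        ((hm1 y (hs hy)).differentiableAt (by simp))
    have key := norm_fderiv_fderiv_le (v := w k - w m) (x₀ := x) (L := γ) (K := 2 * K) hd0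
      (by positivity) hβ hβ1 (fun y hy => (hk1 y (hs hy)).sub (hm1 y (hs hy)))
      (fun y hy => by
        rw [hfd y hy, ← dist_eq_norm]; exact (h2 y (hs hy)).le)
      (fun y hy z hz => by
        rw [hΔ y hy, hΔ z hz]
        have hyz : ‖y - z‖ ≤ 1 := by
          rw [← dist_eq_norm]
          have := dist_triangle_right y z x
          rw [mem_closedBall] at hy hz
          linarith
        have a1 := abs_le.1 (hk2 y (hs hy) z (hs hz) hyz)
        have a2 := abs_le.1 (hm2 y (hs hy) z (hs hz) hyz)
        rw [abs_le]
        constructor <;> linarith)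
    have hfd2 : fderiv ℝ (fderiv ℝ (w k - w m)) x
        = fderiv ℝ (fderiv ℝ (w k)) x - fderiv ℝ (fderiv ℝ (w m)) x := by
      have h : fderiv ℝ (w k - w m) =ᶠ[𝓝 x] fderiv ℝ (w k) - fderiv ℝ (w m) :=
        Filter.eventuallyEq_of_mem (closedBall_mem_nhds x hd0) hfd
      rw [h.fderiv_eq]
      exact fderiv_sub
        (((hk1 x (hs hxx)).fderiv_right (m := 1) (by norm_num)).differentiableAt (by simp))
        (((hm1 x (hs hxx)).fderiv_right (m := 1) (by norm_num)).differentiableAt (by simp))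
    rw [hfd2, hΔ x hxx, ← hn] at key
    have h3x : |Δ (w k) x - Δ (w m) x| ≤ γ := by
      have := h3 x (hs hxx)
      rw [Real.dist_eq] at this
      exact this.le
    have hdd := hd d hd0.le hdδ
    have hdist : ∀ a b : E →L[ℝ] E →L[ℝ] ℝ, ‖a - b‖ < ε → dist a b < ε := fun a b hab =>
      (dist_eq_norm a b).trans_lt hab
    refine hdist _ _ ?_
    calc _ ≤ _ := key
      _ ≤ n ^ 2 * (2 * ((2 * n + 6) * γ / d + 2 * K * d ^ β / β) + γ) := by gcongr
      _ = γ * A + n ^ 2 * (2 * (2 * K / β)) * d ^ β := by rw [hA]; field_simp; ring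
      _ < ε := by linarith
  have hev : ∀ x : E, ∀ᶠ m : ι × E in (𝒰 : Filter ι) ×ˢ 𝓝 x, ContDiffAt ℝ 2 (w m.1) m.2 := by
    intro x
    have hb : ball (0 : E) (‖x‖ + 1) ∈ 𝓝 x := isOpen_ball.mem_nhds (by simp)
    filter_upwards [(hC (‖x‖ + 1)).prod_mk (eventually_mem_set.2 hb)] with m hm using hm.1 _ hm.2
  obtain ⟨W, hW, -⟩ := exists_tendstoUniformlyOn_ball U1
  obtain ⟨G, hG, hGu⟩ := exists_tendstoUniformlyOn_ball U2
  obtain ⟨H, hH, hHu⟩ := exists_tendstoUniformlyOn_ball (G := E →L[ℝ] E →L[ℝ] ℝ) U4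
  have dW : ∀ x, HasFDerivAt W (G x) x := fun x =>
    hasFDerivAt_of_tendstoUniformlyOnFilter (tendstoUniformlyOnFilter_of_ball hGu x)
      ((hev x).mono fun m hm => (hm.differentiableAt (by simp)).hasFDerivAt)
      (Eventually.of_forall hW)
  have dG : ∀ x, HasFDerivAt G (H x) x := fun x =>
    hasFDerivAt_of_tendstoUniformlyOnFilter (tendstoUniformlyOnFilter_of_ball hHu x)
      ((hev x).mono fun m hm => ((hm.fderiv_right (m := 1) (by norm_num)).differentiableAt
        (by simp)).hasFDerivAt)
      (Eventually.of_forall hG)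
  have cH : Continuous H := by
    rw [continuous_iff_continuousAt]
    intro x
    have hb : ball (0 : E) (‖x‖ + 1) ∈ 𝓝 x := isOpen_ball.mem_nhds (by simp)
    refine ((hHu (‖x‖ + 1)).continuousOn (Eventually.frequently ?_)).continuousAt hb
    filter_upwards [hC (‖x‖ + 1)] with k hk y hy
    exact (((hk y hy).fderiv_right (m := 1) (by norm_num)).fderiv_right (m := 0)
      (by norm_num)).continuousAt.continuousWithinAt
  have eG : fderiv ℝ W = G := funext fun x => (dW x).fderiv
  have eH : fderiv ℝ G = H := funext fun x => (dG x).fderiv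
  refine ⟨W, ?_, fun x => ⟨hW x, by rw [eG]; exact hG x, ?_⟩⟩
  · rw [show (2 : WithTop ℕ∞) = ((1 : ℕ) : WithTop ℕ∞) + 1 by norm_num,
      contDiff_succ_iff_hasFDerivAt]
    exact ⟨G, by simpa using contDiff_one_iff_hasFDerivAt.2 ⟨H, cH, dG⟩, dW⟩
  · have b := stdOrthonormalBasis ℝ E
    simp only [laplacian_eq_sum_fderiv_fderiv b, eG, eH]
    exact tendsto_finsetSum _ fun i _ =>
      ((ContinuousLinearMap.apply ℝ ℝ (b i)).continuous.comp
        (ContinuousLinearMap.apply ℝ (E →L[ℝ] ℝ) (b i)).continuous).continuousAt.tendsto.comp (hH x)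

theorem hasJet_doubling {w : E → ℝ} {x y : E} (hx : ContDiffAt ℝ 2 w x) (hy : ContDiffAt ℝ 2 w y)
    (A κ : ℝ) (ξ η : E) :
    HasJet (fun t : ℝ => ((w (x + t • ξ) - w (y + t • η))
        - A / 2 * ‖x - y + t • (ξ - η)‖ ^ 2) - κ * ‖x + t • ξ‖ ^ 2)
      (w x - w y - A / 2 * ‖x - y‖ ^ 2 - κ * ‖x‖ ^ 2)
      (fderiv ℝ w x ξ - fderiv ℝ w y η - A * inner ℝ (x - y) (ξ - η) - 2 * κ * inner ℝ x ξ)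
      (fderiv ℝ (fderiv ℝ w) x ξ ξ - fderiv ℝ (fderiv ℝ w) y η η - A * ‖ξ - η‖ ^ 2
        - 2 * κ * ‖ξ‖ ^ 2) :=
  ((((hx.hasJet ξ).sub (hy.hasJet η)).sub ((hasJet_norm_sq (x - y) (ξ - η)).const_mul (A / 2))).sub
    ((hasJet_norm_sq x ξ).const_mul κ)).congr_coeff rfl (by ring) (by ring)

/-- At an interior maximum of the doubled function
`w x - w y - A / 2 * ‖x - y‖ ^ 2 - κ * ‖x‖ ^ 2`. -/
theorem doubling_of_isLocalMax [FiniteDimensional ℝ E] [Nontrivial E] {w : E → ℝ} {x y : E}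
    {A κ : ℝ} (hA : 0 < A) (hx : ContDiffAt ℝ 2 w x) (hy : ContDiffAt ℝ 2 w y)
    (hmax : IsLocalMax (fun p : E × E =>
      w p.1 - w p.2 - A / 2 * ‖p.1 - p.2‖ ^ 2 - κ * ‖p.1‖ ^ 2) (x, y)) :
    fderiv ℝ w x = innerSL ℝ (A • (x - y) + (2 * κ) • x) ∧
    fderiv ℝ w y = innerSL ℝ (A • (x - y)) ∧
    (Δ w y ≤ 0 → Δ w y ^ 2 / (Module.finrank ℝ E * A) ≤
      -Δ w x + Δ w y + 2 * Module.finrank ℝ E * κ) := by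
  have hloc : ∀ ξ η : E, IsLocalMax (fun t : ℝ => ((w (x + t • ξ) - w (y + t • η))
        - A / 2 * ‖x - y + t • (ξ - η)‖ ^ 2) - κ * ‖x + t • ξ‖ ^ 2) 0 := by
    intro ξ η
    have hc : ContinuousAt (fun t : ℝ => (x + t • ξ, y + t • η)) 0 := by fun_prop
    have h1 : ∀ᶠ p in 𝓝 ((fun t : ℝ => (x + t • ξ, y + t • η)) 0),
        w p.1 - w p.2 - A / 2 * ‖p.1 - p.2‖ ^ 2 - κ * ‖p.1‖ ^ 2 ≤
          w x - w y - A / 2 * ‖x - y‖ ^ 2 - κ * ‖x‖ ^ 2 := by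
      simp only [zero_smul, add_zero]
      exact hmax
    filter_upwards [hc.eventually h1] with t ht
    simp only [zero_smul, add_zero] at ht ⊢
    rw [show x - y + t • (ξ - η) = x + t • ξ - (y + t • η) by module]
    exact ht
  have h1 := fun ξ η => ((hasJet_doubling hx hy A κ ξ η).eq_zero_and_nonpos_of_isLocalMax
    (hloc ξ η)).1
  have h2 := fun ξ η => ((hasJet_doubling hx hy A κ ξ η).eq_zero_and_nonpos_of_isLocalMax
    (hloc ξ η)).2
  refine ⟨?_, ?_, ?_⟩
  · ext ξ
    have := h1 ξ 0
    simp only [map_zero, sub_zero] at this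
    rw [innerSL_apply_apply, inner_add_left, real_inner_smul_left, real_inner_smul_left]
    linarith
  · ext η
    have := h1 0 η
    simp only [map_zero, zero_sub, inner_neg_right, inner_zero_right] at this
    rw [innerSL_apply_apply, real_inner_smul_left]
    linarith
  · intro hy0
    set n : ℝ := ((Module.finrank ℝ E : ℕ) : ℝ) with hn
    have hn0 : 0 < n := by rw [hn]; exact_mod_cast Module.finrank_pos
    set t := -Δ w y / (n * A) with ht
    let b := stdOrthonormalBasis ℝ E
    have h3 : ∑ i, (fderiv ℝ (fderiv ℝ w) x (b i) (b i)
        - (1 + t) ^ 2 * fderiv ℝ (fderiv ℝ w) y (b i) (b i) - A * t ^ 2 - 2 * κ) ≤ 0 := by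
      refine Finset.sum_nonpos fun i _ => ?_
      have := h2 (b i) ((1 + t) • b i)
      have e : ‖b i - (1 + t) • b i‖ ^ 2 = t ^ 2 := by
        rw [show b i - (1 + t) • b i = (-t) • b i by module, norm_smul]
        simp
      rw [e] at this
      simp only [map_smul, smul_apply, smul_eq_mul, b.norm_eq_one] at this
      linarith
    simp only [Finset.sum_sub_distrib, ← Finset.mul_sum,
      ← laplacian_eq_sum_fderiv_fderiv b] at h3
    simp only [Finset.sum_const, Finset.card_univ, Fintype.card_fin, nsmul_eq_mul, ← hn] at h3
    have h4 : n * A * t = -Δ w y := by rw [ht]; field_simp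
    have h5 : Δ w y ^ 2 / (n * A) = n * A * t ^ 2 := by rw [ht]; field_simp
    have h6 : 0 ≤ t ^ 2 * (-Δ w y) := mul_nonneg (sq_nonneg t) (by linarith)
    have h7 : n * A * t ^ 2 = t * (-Δ w y) := by rw [← h4]; ring
    rw [h5]
    linarith

theorem eventually_doubling_ge [FiniteDimensional ℝ E] {w : E → ℝ} (hw : DifferentiableAt ℝ w 0)
    (h0 : 0 < ‖fderiv ℝ w 0‖) :
    ∃ g : E, ‖g‖ = ‖fderiv ℝ w 0‖ ∧ ∀ᶠ A in (atTop : Filter ℝ), ‖fderiv ℝ w 0‖ ^ 2 / (4 * A) ≤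
      w 0 - w (-A⁻¹ • g) - A / 2 * ‖0 - -A⁻¹ • g‖ ^ 2 := by
  set a := ‖fderiv ℝ w 0‖ with ha
  obtain ⟨g, hg⟩ := (InnerProductSpace.toDual ℝ E).surjective (fderiv ℝ w 0)
  have hga : ‖g‖ = a := by rw [ha, ← hg, LinearIsometryEquiv.norm_map]
  refine ⟨g, hga, ?_⟩
  have hd : HasDerivAt (fun s : ℝ => w (-s • g)) (-a ^ 2) 0 := by
    have h1 : HasDerivAt (fun s : ℝ => -s • g) (-(1 : ℝ) • g) 0 :=
      (hasDerivAt_neg (0 : ℝ)).smul_const g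
    have h2 : HasFDerivAt w (fderiv ℝ w 0) (-(0 : ℝ) • g) := by simpa using hw.hasFDerivAt
    refine (h2.comp_hasDerivAt (0 : ℝ) h1).congr_deriv ?_
    rw [← hg, InnerProductSpace.toDual_apply_apply, inner_smul_right, real_inner_self_eq_norm_sq,
      hga]
    ring
  have hs := (hasDerivAt_iff_isLittleO.1 hd).def (c := a ^ 2 / 4) (by positivity)
  have ht : Tendsto (fun A : ℝ => A⁻¹) atTop (𝓝 0) := tendsto_inv_atTop_zero
  filter_upwards [ht.eventually hs, eventually_gt_atTop 0] with A hA hA0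
  simp only [neg_zero, zero_smul, sub_zero, smul_eq_mul, Real.norm_eq_abs,
    abs_of_pos (inv_pos.2 hA0)] at hA
  have h1 := (abs_le.1 hA).2
  have h2 : A / 2 * ‖0 - -A⁻¹ • g‖ ^ 2 = a ^ 2 / 2 * A⁻¹ := by
    rw [zero_sub, norm_neg, norm_smul, hga, Real.norm_eq_abs, abs_neg, abs_of_pos (inv_pos.2 hA0)]
    field_simp
  have h3 : a ^ 2 / (4 * A) = a ^ 2 / 4 * A⁻¹ := by field_simp
  rw [h2, h3]
  linarith

set_option maxHeartbeats 1000000 in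
theorem sq_le_of_le_neg_laplacian [FiniteDimensional ℝ E] [Nontrivial E] {w : E → ℝ}
    {ρ K N₀ Ls Lw : ℝ} (hρ : 0 < ρ) (hK : 0 < K) (hN₀ : 0 ≤ N₀) (hLs : 0 ≤ Ls) (hLw : 0 ≤ Lw)
    (hw : ∀ x ∈ ball (0 : E) (ρ + 2), ContDiffAt ℝ 2 w x)
    (hwK : ∀ x ∈ ball (0 : E) (ρ + 2), ‖fderiv ℝ w x‖ ≤ K) (h0 : 0 < ‖fderiv ℝ w 0‖)
    (hN : ∀ x ∈ ball (0 : E) (ρ + 2), ‖fderiv ℝ w 0‖ ^ 2 / (8 * K) ≤ ‖fderiv ℝ w x‖ →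
      N₀ ≤ -Δ w x)
    (hNL : ∀ x ∈ ball (0 : E) (ρ + 2), ∀ y ∈ ball (0 : E) (ρ + 2),
      ‖fderiv ℝ w 0‖ ^ 2 / (8 * K) ≤ ‖fderiv ℝ w x‖ →
      ‖fderiv ℝ w 0‖ ^ 2 / (8 * K) ≤ ‖fderiv ℝ w y‖ →
      -Δ w x + Δ w y ≤ Ls * |‖fderiv ℝ w x‖ - ‖fderiv ℝ w y‖| + Lw * |w x - w y|) :
    N₀ ^ 2 ≤ Module.finrank ℝ E * (2 * Ls * K ^ 2 / ρ + 2 * Lw * K ^ 2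
      + 2 * Module.finrank ℝ E * K ^ 2 / ρ ^ 2) := by
  have : ProperSpace E := FiniteDimensional.proper ℝ E
  set n : ℝ := ((Module.finrank ℝ E : ℕ) : ℝ) with hn
  have hn0 : 0 < n := by rw [hn]; exact_mod_cast Module.finrank_pos
  have hz : (0 : E) ∈ ball (0 : E) (ρ + 2) := mem_ball_self (by positivity)
  obtain ⟨g, hga, hgA⟩ := eventually_doubling_ge ((hw 0 hz).differentiableAt (by simp)) h0
  set a := ‖fderiv ℝ w 0‖ with ha
  have haK : a ≤ K := hwK 0 hz
  obtain ⟨A, hA1, hA2, hA3⟩ := (hgA.and ((eventually_gt_atTop (2 * K)).and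
    (eventually_ge_atTop (16 * K ^ 3 / (ρ * a ^ 2))))).exists
  have hA0 : 0 < A := by linarith
  set κ := K ^ 2 / (A * ρ ^ 2) with hκ
  have hκ0 : 0 < κ := by positivity
  have hs1 : closedBall (0 : E) ρ ⊆ ball 0 (ρ + 2) := closedBall_subset_ball (by linarith)
  have hs2 : closedBall (0 : E) (ρ + 1) ⊆ ball 0 (ρ + 2) := closedBall_subset_ball (by linarith)
  have hdiff : ∀ x ∈ ball (0 : E) (ρ + 2), DifferentiableAt ℝ w x := fun x hx =>
    (hw x hx).differentiableAt (by simp)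
  have hlip : ∀ x ∈ ball (0 : E) (ρ + 2), ∀ y ∈ ball (0 : E) (ρ + 2), |w x - w y| ≤ K * ‖x - y‖ :=
    fun x hx y hy => (convex_ball (0 : E) (ρ + 2)).norm_image_sub_le_of_norm_fderiv_le hdiff hwK hy hx
  obtain ⟨⟨x, y⟩, ⟨hx, hy⟩, hmax⟩ := ((isCompact_closedBall (0 : E) ρ).prod
    (isCompact_closedBall (0 : E) (ρ + 1))).exists_isMaxOn
    (f := fun p : E × E => w p.1 - w p.2 - A / 2 * ‖p.1 - p.2‖ ^ 2 - κ * ‖p.1‖ ^ 2)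
    ⟨(0, 0), by simp [hρ.le], by simp; linarith⟩ (by
      intro p hp
      have c1 : ContinuousAt w p.1 := (hdiff _ (hs1 hp.1)).continuousAt
      have c2 : ContinuousAt w p.2 := (hdiff _ (hs2 hp.2)).continuousAt
      have c3 : ContinuousAt (fun p : E × E => w p.1) p := c1.comp continuousAt_fst
      have c4 : ContinuousAt (fun p : E × E => w p.2) p := c2.comp continuousAt_snd
      exact (ContinuousAt.sub (ContinuousAt.sub (c3.sub c4) (by fun_prop))
        (by fun_prop)).continuousWithinAt)
  simp only at hx hy
  have hx' := hs1 hx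
  have hy' := hs2 hy
  set s := ‖x - y‖ with hs
  have hs0 : 0 ≤ s := norm_nonneg _
  have hge : a ^ 2 / (4 * A) ≤ w x - w y - A / 2 * s ^ 2 - κ * ‖x‖ ^ 2 := by
    have := hmax (a := ((0 : E), -A⁻¹ • g)) ⟨by simp [hρ.le], by
      rw [mem_closedBall_zero_iff, norm_smul, hga, Real.norm_eq_abs, abs_neg,
        abs_of_pos (inv_pos.2 hA0), inv_mul_le_iff₀ hA0]
      nlinarith⟩
    have h2 : a ^ 2 / (4 * A) ≤ _ := hA1.trans (by simpa using this)
    exact h2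
  have hpos : 0 < a ^ 2 / (4 * A) := by positivity
  have hκx : 0 ≤ κ * ‖x‖ ^ 2 := by positivity
  have hle : w x - w y ≤ K * s := (le_abs_self _).trans (hlip x hx' y hy')
  have hAs : A * s ≤ 2 * K := by
    by_contra! h
    have : 0 < s := by
      by_contra! h'
      have : s = 0 := le_antisymm h' hs0
      rw [this] at h; linarith
    nlinarith
  have hs1' : s < 1 := by
    by_contra! h
    nlinarith
  have hKs : K * s - A / 2 * s ^ 2 ≤ K ^ 2 / (2 * A) := by
    rw [le_div_iff₀ (by positivity)]
    nlinarith [sq_nonneg (A * s - K)]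
  have hxρ : ‖x‖ < ρ := by
    have h1 : κ * ‖x‖ ^ 2 < κ * ρ ^ 2 := by
      have : κ * ρ ^ 2 = K ^ 2 / A := by rw [hκ]; field_simp
      have h3 : K ^ 2 / (2 * A) < K ^ 2 / A := by
        apply div_lt_div_of_pos_left <;> first | positivity | linarith
      rw [this]
      linarith
    exact lt_of_pow_lt_pow_left₀ 2 hρ.le (lt_of_mul_lt_mul_left h1 hκ0.le)
  have hyρ : ‖y‖ < ρ + 1 := by
    have := norm_sub_norm_le y x
    rw [norm_sub_rev, ← hs] at this
    linarith
  have hloc : IsLocalMax (fun p : E × E =>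
      w p.1 - w p.2 - A / 2 * ‖p.1 - p.2‖ ^ 2 - κ * ‖p.1‖ ^ 2) (x, y) :=
    hmax.isLocalMax (prod_mem_nhds (closedBall_mem_nhds_of_mem (by simpa using hxρ))
      (closedBall_mem_nhds_of_mem (by simpa using hyρ)))
  have hAs' : a ^ 2 / (4 * K) ≤ A * s := by
    have h1 : a ^ 2 / (4 * A) ≤ K * s := by nlinarith [sq_nonneg s]
    rw [div_le_iff₀ (by positivity)] at h1 ⊢
    linarith
  obtain ⟨hgx, hgy, hΔ⟩ := doubling_of_isLocalMax hA0 (hw x hx') (hw y hy') hloc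
  have hny : ‖fderiv ℝ w y‖ = A * s := by
    rw [hgy, innerSL_apply_norm, norm_smul, Real.norm_of_nonneg hA0.le]
  have hdxy : |‖fderiv ℝ w x‖ - ‖fderiv ℝ w y‖| ≤ 2 * K ^ 2 / (A * ρ) := by
    rw [hgx, hgy, innerSL_apply_norm, innerSL_apply_norm]
    refine (abs_norm_sub_norm_le _ _).trans ?_
    rw [add_sub_cancel_left, norm_smul, Real.norm_of_nonneg (by positivity)]
    calc 2 * κ * ‖x‖ ≤ 2 * κ * ρ := by gcongr
      _ = _ := by rw [hκ]; field_simp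
  have hsmall : 2 * K ^ 2 / (A * ρ) ≤ a ^ 2 / (8 * K) := by
    rw [div_le_iff₀ (by positivity)] at hA3
    rw [div_le_div_iff₀ (by positivity) (by positivity)]
    linarith
  have h48 : a ^ 2 / (4 * K) = a ^ 2 / (8 * K) + a ^ 2 / (8 * K) := by field_simp; norm_num
  have h80 : 0 < a ^ 2 / (8 * K) := by positivity
  have ty : a ^ 2 / (8 * K) ≤ ‖fderiv ℝ w y‖ := by rw [hny]; linarith
  have tx : a ^ 2 / (8 * K) ≤ ‖fderiv ℝ w x‖ := by
    have := (abs_le.1 hdxy).1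
    rw [hny] at this
    linarith
  have hNy := hN y hy' ty
  have hfin := hΔ (by linarith)
  have hwxy : |w x - w y| ≤ 2 * K ^ 2 / A := by
    refine (hlip x hx' y hy').trans ?_
    rw [le_div_iff₀ hA0]
    nlinarith
  have h1 := hNL x hx' y hy' tx ty
  have h2 : Ls * |‖fderiv ℝ w x‖ - ‖fderiv ℝ w y‖| ≤ Ls * (2 * K ^ 2 / (A * ρ)) := by gcongr
  have h3 : Lw * |w x - w y| ≤ Lw * (2 * K ^ 2 / A) := by gcongr
  have h4 : N₀ ^ 2 ≤ Δ w y ^ 2 := by nlinarith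
  rw [← hn, div_le_iff₀ (by positivity)] at hfin
  calc N₀ ^ 2 ≤ Δ w y ^ 2 := h4
    _ ≤ (-Δ w x + Δ w y + 2 * n * κ) * (n * A) := hfin
    _ ≤ (Ls * (2 * K ^ 2 / (A * ρ)) + Lw * (2 * K ^ 2 / A) + 2 * n * κ) * (n * A) :=
      mul_le_mul_of_nonneg_right (by linarith) (by positivity)
    _ = _ := by rw [hκ]; field_simp

theorem exists_abs_rpow_sub_rpow_le (q : ℝ) {k K : ℝ} (hk : 0 < k) :
    ∃ Λ, 0 ≤ Λ ∧ ∀ s ∈ Icc k K, ∀ t ∈ Icc k K, |s ^ q - t ^ q| ≤ Λ * |s - t| := by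
  have hc : ContinuousOn (fun s : ℝ => q * s ^ (q - 1)) (Icc k K) := fun s hs =>
    ((Real.continuousAt_rpow_const s (q - 1) (Or.inl (hk.trans_le hs.1).ne')).const_mul
      q).continuousWithinAt
  obtain ⟨C, hC⟩ := isCompact_Icc.exists_bound_of_continuousOn hc
  refine ⟨max C 0, le_max_right _ _, fun s hs t ht => ?_⟩
  exact (convex_Icc k K).norm_image_sub_le_of_norm_hasDerivWithin_le (f := fun s => s ^ q)
    (fun x hx => (Real.hasDerivAt_rpow_const (Or.inl (hk.trans_le hx.1).ne')).hasDerivWithinAt)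
    (fun x hx => (hC x hx).trans (le_max_left _ _)) ht hs

theorem abs_rpow_sub_rpow_le_of_le_one {q s t : ℝ} (hq : 0 ≤ q) (hq1 : q ≤ 1) (hs : 0 ≤ s)
    (ht : 0 ≤ t) : |s ^ q - t ^ q| ≤ |s - t| ^ q := by
  wlog h : t ≤ s generalizing s t
  · rw [abs_sub_comm, abs_sub_comm s]
    exact this ht hs (le_of_not_ge h)
  have h1 := Real.rpow_add_le_add_rpow (sub_nonneg.2 h) ht hq hq1
  have h2 := Real.rpow_le_rpow ht h hq
  rw [abs_of_nonneg (sub_nonneg.2 h), abs_of_nonneg (sub_nonneg.2 h2)]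
  rw [sub_add_cancel] at h1
  linarith

theorem exists_abs_rpow_sub_rpow_le_rpow {q : ℝ} (hq : 0 ≤ q) (K : ℝ) :
    ∃ H θ : ℝ, 0 ≤ H ∧ 0 < θ ∧ θ ≤ 1 ∧ ∀ s ∈ Icc 0 K, ∀ t ∈ Icc 0 K,
      |s ^ q - t ^ q| ≤ H * |s - t| ^ θ := by
  rcases hq.eq_or_lt with rfl | hq0
  · exact ⟨0, 1, le_rfl, one_pos, le_rfl, fun s _ t _ => by simp⟩
  rcases le_total q 1 with hq1 | hq1
  · exact ⟨1, q, zero_le_one, hq0, hq1, fun s hs t ht => by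
      simpa using abs_rpow_sub_rpow_le_of_le_one hq hq1 hs.1 ht.1⟩
  · refine ⟨q * K ^ (q - 1) ⊔ 0, 1, le_max_right _ _, one_pos, le_rfl, fun s hs t ht => ?_⟩
    rw [Real.rpow_one]
    refine (convex_Icc 0 K).norm_image_sub_le_of_norm_hasDerivWithin_le (f := fun s => s ^ q)
      (fun x hx => (Real.hasDerivAt_rpow_const (Or.inr hq1)).hasDerivWithinAt)
      (fun x hx => ?_) ht hs
    rw [Real.norm_of_nonneg (mul_nonneg hq (Real.rpow_nonneg hx.1 _))]
    exact (mul_le_mul_of_nonneg_left (Real.rpow_le_rpow hx.1 hx.2 (by linarith)) hq).trans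
      (le_max_left _ _)

theorem exp_mul_le {b T v : ℝ} (hv : |v| ≤ T) : Real.exp (b * v) ≤ Real.exp (|b| * T) := by
  refine Real.exp_le_exp.2 ((le_abs_self _).trans ?_)
  rw [abs_mul]
  gcongr

theorem abs_exp_mul_sub_exp_mul_le {b T v v' : ℝ} (hv : |v| ≤ T) (hv' : |v'| ≤ T) :
    |Real.exp (b * v) - Real.exp (b * v')| ≤ |b| * Real.exp (|b| * T) * |v - v'| := by
  refine (convex_Icc (-T) T).norm_image_sub_le_of_norm_hasDerivWithin_le
    (f := fun v => Real.exp (b * v)) (f' := fun v => Real.exp (b * v) * b)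
    (fun x hx => ?_) (fun x hx => ?_) (abs_le.1 hv') (abs_le.1 hv)
  · have := (hasDerivAt_id x).const_mul b
    simpa using (this.exp).hasDerivWithinAt
  · rw [norm_mul, Real.norm_of_nonneg (Real.exp_pos _).le, mul_comm, Real.norm_eq_abs]
    exact mul_le_mul_of_nonneg_left (exp_mul_le (abs_le.2 hx)) (abs_nonneg b)

theorem le_exp_mul {b T v : ℝ} (hv : |v| ≤ T) : Real.exp (-(|b| * T)) ≤ Real.exp (b * v) := by
  refine Real.exp_le_exp.2 (neg_le.1 ((neg_le_abs _).trans ?_))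
  rw [abs_mul]
  gcongr

/-- Variation of the nonlinearity `s ^ 2 + S * exp (b * v)`. -/
theorem abs_reaction_sub_le {b T K Q s t S S' v v' : ℝ} (hv : |v| ≤ T) (hv' : |v'| ≤ T)
    (hs : s ∈ Icc 0 K) (ht : t ∈ Icc 0 K) (hS' : S' ∈ Icc 0 Q) :
    |(s ^ 2 + S * Real.exp (b * v)) - (t ^ 2 + S' * Real.exp (b * v'))| ≤
      2 * K * |s - t| + Real.exp (|b| * T) * |S - S'|
        + Q * (|b| * Real.exp (|b| * T)) * |v - v'| := by
  have e : (s ^ 2 + S * Real.exp (b * v)) - (t ^ 2 + S' * Real.exp (b * v')) =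
      (s + t) * (s - t) + Real.exp (b * v) * (S - S')
        + S' * (Real.exp (b * v) - Real.exp (b * v')) := by ring
  rw [e]
  refine (abs_add_three _ _ _).trans ?_
  rw [abs_mul, abs_mul, abs_mul, abs_of_nonneg (add_nonneg hs.1 ht.1), abs_of_nonneg hS'.1,
    Real.abs_exp, mul_assoc Q]
  refine add_le_add_three ?_ ?_ ?_
  · have := hs.2; have := ht.2
    gcongr; linarith
  · have := exp_mul_le (b := b) hv
    gcongr
  · exact mul_le_mul hS'.2 (abs_exp_mul_sub_exp_mul_le hv hv') (abs_nonneg _)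
      (hS'.1.trans hS'.2)

/-- A solution of `Δ w + |∇w| ^ 2 + c |∇w| ^ q exp (b w) = 0` on the ball of radius `R`, normalized
at the origin and with controlled gradient. -/
structure IsNormalizedSolution [FiniteDimensional ℝ E] (q b c R : ℝ) (w : E → ℝ) : Prop where
  contDiffAt : ∀ x ∈ ball (0 : E) R, ContDiffAt ℝ 2 w x
  laplacian_eq : ∀ x ∈ ball (0 : E) R,
    Δ w x = -(‖fderiv ℝ w x‖ ^ 2 + c * ‖fderiv ℝ w x‖ ^ q * Real.exp (b * w x))
  zero : w 0 = 0
  norm_le : ∀ x ∈ ball (0 : E) R, ‖fderiv ℝ w x‖ ≤ 2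
  reaction_le : ∀ x ∈ ball (0 : E) R, c * ‖fderiv ℝ w x‖ ^ q * Real.exp (b * w x) ≤ 4
  norm_add_sqrt : ‖fderiv ℝ w 0‖ + √(c * ‖fderiv ℝ w 0‖ ^ q) = 1

namespace IsNormalizedSolution

variable [FiniteDimensional ℝ E] {q b c R : ℝ} {w : E → ℝ}

theorem mono {R' : ℝ} (h : IsNormalizedSolution q b c R w) (hR : R' ≤ R) :
    IsNormalizedSolution q b c R' w :=
  have hs := ball_subset_ball (x := (0 : E)) hR
  ⟨fun x hx => h.1 x (hs hx), fun x hx => h.2 x (hs hx), h.3, fun x hx => h.4 x (hs hx),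
    fun x hx => h.5 x (hs hx), h.6⟩

theorem abs_sub_le (h : IsNormalizedSolution q b c R w) {x y : E} (hx : x ∈ ball (0 : E) R)
    (hy : y ∈ ball (0 : E) R) : |w x - w y| ≤ 2 * ‖x - y‖ :=
  (convex_ball (0 : E) R).norm_image_sub_le_of_norm_fderiv_le
    (fun z hz => (h.contDiffAt z hz).differentiableAt (by simp)) h.norm_le hy hx

theorem abs_le (h : IsNormalizedSolution q b c R w) {x : E} (hx : x ∈ ball (0 : E) R) :
    |w x| ≤ 2 * R := by
  have hx' := mem_ball_zero_iff.1 hx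
  have h1 := h.abs_sub_le hx (mem_ball_self ((norm_nonneg x).trans_lt hx'))
  rw [h.zero, sub_zero, sub_zero] at h1
  linarith

theorem norm_zero_le (h : IsNormalizedSolution q b c R w) : ‖fderiv ℝ w 0‖ ≤ 1 := by
  have := h.norm_add_sqrt
  have := Real.sqrt_nonneg (c * ‖fderiv ℝ w 0‖ ^ q)
  linarith

theorem abs_laplacian_le (h : IsNormalizedSolution q b c R w) (hc : 0 ≤ c) {x : E}
    (hx : x ∈ ball (0 : E) R) : |Δ w x| ≤ 8 := by
  have h1 := h.norm_le x hx
  have h2 := h.reaction_le x hx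
  have h3 : 0 ≤ c * ‖fderiv ℝ w x‖ ^ q * Real.exp (b * w x) := by positivity
  rw [h.laplacian_eq x hx, abs_neg, abs_of_nonneg (by positivity)]
  nlinarith [norm_nonneg (fderiv ℝ w x)]

end IsNormalizedSolution

theorem exists_not_isNormalizedSolution_of_le [FiniteDimensional ℝ E] [Nontrivial E] {q : ℝ}
    (hq : 0 ≤ q) (b : ℝ) :
    ∃ c₁ R : ℝ, 0 < c₁ ∧ ∀ c, 0 < c → c ≤ c₁ → ∀ w : E → ℝ, ¬ IsNormalizedSolution q b c R w := by
  obtain ⟨Λ, hΛ0, hΛ⟩ := exists_abs_rpow_sub_rpow_le q (k := 1 / 64) (K := 2) (by norm_num)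
  set n : ℝ := ((Module.finrank ℝ E : ℕ) : ℝ) with hn
  have hn0 : 0 < n := by rw [hn]; exact_mod_cast Module.finrank_pos
  obtain ⟨ρ, hρ, hρ0⟩ : ∃ ρ : ℝ,
      n * (2 * 4 * 2 ^ 2 / ρ + 2 * n * 2 ^ 2 / ρ ^ 2) < ((1 / 64 : ℝ) ^ 2) ^ 2 ∧ 0 < ρ := by
    have h1 : Tendsto (fun ρ : ℝ => n * (2 * 4 * 2 ^ 2 / ρ + 2 * n * 2 ^ 2 / ρ ^ 2)) atTop
        (𝓝 (n * (0 + 0))) :=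
      ((tendsto_const_nhds.div_atTop tendsto_id).add
        (tendsto_const_nhds.div_atTop (tendsto_pow_atTop two_ne_zero))).const_mul n
    rw [add_zero, mul_zero] at h1
    exact ((h1.eventually_lt_const (by positivity)).and (eventually_gt_atTop 0)).exists
  set B := Real.exp (|b| * (2 * (ρ + 2))) with hB
  have hB0 : 0 < B := Real.exp_pos _
  have hG : ∀ᶠ c in 𝓝 (0 : ℝ), n * (2 * (4 + B * (c * Λ)) * 2 ^ 2 / ρ
      + 2 * (c * 2 ^ q * (|b| * B)) * 2 ^ 2 + 2 * n * 2 ^ 2 / ρ ^ 2) < ((1 / 64 : ℝ) ^ 2) ^ 2 := by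
    have hc : ContinuousAt (fun c : ℝ => n * (2 * (4 + B * (c * Λ)) * 2 ^ 2 / ρ
      + 2 * (c * 2 ^ q * (|b| * B)) * 2 ^ 2 + 2 * n * 2 ^ 2 / ρ ^ 2)) 0 := by fun_prop
    refine hc.eventually_lt_const (lt_of_eq_of_lt ?_ hρ)
    ring
  obtain ⟨ε, hε, hball⟩ := Metric.eventually_nhds_iff_ball.1 hG
  refine ⟨min (ε / 2) (1 / 4), ρ + 2, by positivity, fun c hc hc1 w hw => ?_⟩
  have hcε : c ≤ ε / 2 := hc1.trans (min_le_left _ _)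
  have hc4 : c ≤ 1 / 4 := hc1.trans (min_le_right _ _)
  have ha1 := hw.norm_zero_le
  have ha : 1 / 2 ≤ ‖fderiv ℝ w 0‖ := by
    have h1 : ‖fderiv ℝ w 0‖ ^ q ≤ 1 := Real.rpow_le_one (norm_nonneg _) ha1 hq
    have h2 : √(c * ‖fderiv ℝ w 0‖ ^ q) ≤ 1 / 2 := by
      rw [Real.sqrt_le_left (by norm_num)]
      have : 0 ≤ ‖fderiv ℝ w 0‖ ^ q := by positivity
      nlinarith
    linarith [hw.norm_add_sqrt]
  have h64 : (1 / 64 : ℝ) ≤ ‖fderiv ℝ w 0‖ ^ 2 / (8 * 2) := by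
    rw [le_div_iff₀ (by norm_num)]; nlinarith
  have key := sq_le_of_le_neg_laplacian (w := w) (ρ := ρ) (K := 2) (N₀ := (1 / 64) ^ 2)
    (Ls := 4 + B * (c * Λ)) (Lw := c * 2 ^ q * (|b| * B)) hρ0 two_pos (by norm_num) (by positivity)
    (by positivity) hw.contDiffAt hw.norm_le (by linarith) (fun x hx hgx => ?_)
    (fun x hx y hy hgx hgy => ?_)
  · exact absurd (hball c (by rw [mem_ball_zero_iff, Real.norm_of_nonneg hc.le]; linarith))
      (not_lt.2 key)
  · rw [hw.laplacian_eq x hx, neg_neg]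
    have h3 : 0 ≤ c * ‖fderiv ℝ w x‖ ^ q * Real.exp (b * w x) := by positivity
    have h4 : (1 / 64 : ℝ) ^ 2 ≤ ‖fderiv ℝ w x‖ ^ 2 := by gcongr; linarith
    linarith
  · rw [hw.laplacian_eq x hx, hw.laplacian_eq y hy, neg_neg, ← sub_eq_add_neg]
    have h2 := hw.norm_le y hy
    refine (le_abs_self _).trans ((abs_reaction_sub_le (hw.abs_le hx) (hw.abs_le hy)
      (K := 2) (Q := c * 2 ^ q) ⟨norm_nonneg _, hw.norm_le x hx⟩ ⟨norm_nonneg _, h2⟩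
      ⟨by positivity, by gcongr⟩).trans ?_)
    have h5 := hΛ _ ⟨h64.trans hgx, hw.norm_le x hx⟩ _ ⟨h64.trans hgy, h2⟩
    rw [← mul_sub, abs_mul, abs_of_pos hc]
    have h6 := mul_le_mul_of_nonneg_left h5 (mul_pos hB0 hc).le
    nlinarith

theorem exists_not_isNormalizedSolution_of_ge [FiniteDimensional ℝ E] [Nontrivial E] {q : ℝ}
    (hq : 0 ≤ q) (b : ℝ) :
    ∃ c₀ R : ℝ, 0 < c₀ ∧ ∀ c, c₀ ≤ c → ∀ w : E → ℝ, ¬ IsNormalizedSolution q b c R w := by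
  rcases hq.eq_or_lt with rfl | hq0
  · refine ⟨2, 0, two_pos, fun c hc w hw => ?_⟩
    have h1 := hw.norm_add_sqrt
    rw [Real.rpow_zero, mul_one] at h1
    have h2 : √c ≤ 1 := by linarith [norm_nonneg (fderiv ℝ w 0)]
    rw [Real.sqrt_le_one] at h2
    linarith
  set B := Real.exp (|b| * (2 * (1 + 2))) with hB
  have hB0 : 0 < B := Real.exp_pos _
  set k₁ : ℝ := (1 / 4) ^ q⁻¹ with hk₁
  set k₂ : ℝ := (4 * B) ^ q⁻¹ with hk₂
  have hk₁0 : 0 < k₁ := by positivity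
  have hk₂0 : 0 < k₂ := by positivity
  have hk₁q : k₁ ^ q = 1 / 4 := Real.rpow_inv_rpow (by norm_num) hq0.ne'
  have hk₂q : k₂ ^ q = 4 * B := Real.rpow_inv_rpow (by positivity) hq0.ne'
  set k₃ := k₁ ^ 2 / (8 * k₂) with hk₃
  have hk₃0 : 0 < k₃ := by positivity
  obtain ⟨Λ, hΛ0, hΛ⟩ := exists_abs_rpow_sub_rpow_le q (k := k₃) (K := k₂) hk₃0
  set n : ℝ := ((Module.finrank ℝ E : ℕ) : ℝ) with hn
  have hn0 : 0 < n := by rw [hn]; exact_mod_cast Module.finrank_pos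
  have hN0 : 0 < (k₃ ^ q * B⁻¹) ^ 2 := by positivity
  have hG : ∀ᶠ σ in 𝓝 (0 : ℝ), n * (4 * k₂ ^ 3 * σ ^ 3 + 2 * B * Λ * k₂ ^ 2 * σ
      + 2 * (k₂ ^ q * (|b| * B)) * (k₂ * σ) ^ 2 + 2 * n * (k₂ * σ) ^ 2)
        < (k₃ ^ q * B⁻¹) ^ 2 ∧ k₂ * σ < 1 / 2 := by
    have hc : ContinuousAt (fun σ : ℝ => n * (4 * k₂ ^ 3 * σ ^ 3 + 2 * B * Λ * k₂ ^ 2 * σ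
      + 2 * (k₂ ^ q * (|b| * B)) * (k₂ * σ) ^ 2 + 2 * n * (k₂ * σ) ^ 2)) 0 := by fun_prop
    have hc' : ContinuousAt (fun σ : ℝ => k₂ * σ) 0 := by fun_prop
    refine (hc.eventually_lt_const (lt_of_eq_of_lt ?_ hN0)).and
      (hc'.eventually_lt_const (by norm_num))
    ring
  obtain ⟨ε, hε, hball⟩ := Metric.eventually_nhds_iff_ball.1 hG
  refine ⟨(ε / 2) ^ (-q), 1 + 2, by positivity, fun c hc w hw => ?_⟩
  have hc0 : 0 < c := lt_of_lt_of_le (by positivity) hc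
  set σ : ℝ := c ^ (-q⁻¹) with hσ
  have hσ0 : 0 < σ := by positivity
  have hσq : c = (σ ^ q)⁻¹ := by
    rw [hσ, ← Real.rpow_mul hc0.le, neg_mul, inv_mul_cancel₀ hq0.ne', Real.rpow_neg_one, inv_inv]
  have hσε : σ ≤ ε / 2 := by
    have h1 : (ε / 2) ^ (-q) ≤ σ ^ (-q) := by rwa [Real.rpow_neg hσ0.le, ← hσq]
    exact (Real.rpow_le_rpow_iff_of_neg (by positivity) hσ0 (neg_neg_of_pos hq0)).1 h1
  obtain ⟨hG1, hG2⟩ := hball σ (by rw [mem_ball_zero_iff, Real.norm_of_nonneg hσ0.le]; linarith)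
  have hcs : ∀ s : ℝ, 0 ≤ s → c * s ^ q = (s / σ) ^ q := fun s hs => by
    rw [Real.div_rpow hs hσ0.le, hσq]; ring
  have hz : (0 : E) ∈ ball (0 : E) (1 + 2) := mem_ball_self (by norm_num)
  have hle : ∀ x ∈ ball (0 : E) (1 + 2), ‖fderiv ℝ w x‖ / σ ≤ k₂ := fun x hx => by
    have h1 := hw.reaction_le x hx
    have h2 := le_exp_mul (b := b) (hw.abs_le hx)
    rw [Real.exp_neg, ← hB] at h2
    have h3 : c * ‖fderiv ℝ w x‖ ^ q * B⁻¹ ≤ 4 := le_trans (by gcongr) h1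
    rw [hcs _ (norm_nonneg _), ← div_eq_mul_inv, div_le_iff₀ hB0, ← hk₂q] at h3
    exact (Real.rpow_le_rpow_iff (by positivity) hk₂0.le hq0).1 h3
  have hleK : ∀ x ∈ ball (0 : E) (1 + 2), ‖fderiv ℝ w x‖ ≤ k₂ * σ := fun x hx =>
    (div_le_iff₀ hσ0).1 (hle x hx)
  have ha : k₁ * σ ≤ ‖fderiv ℝ w 0‖ := by
    have h1 : 1 / 2 ≤ √(c * ‖fderiv ℝ w 0‖ ^ q) := by
      linarith [hw.norm_add_sqrt, hleK 0 hz]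
    rw [Real.le_sqrt' (by norm_num), hcs _ (norm_nonneg _)] at h1
    rw [← le_div_iff₀ hσ0]
    refine (Real.rpow_le_rpow_iff hk₁0.le (by positivity) hq0).1 ?_
    rw [hk₁q]
    linarith
  have ha3 : k₃ * σ ≤ ‖fderiv ℝ w 0‖ ^ 2 / (8 * (k₂ * σ)) := by
    rw [le_div_iff₀ (by positivity)]
    calc k₃ * σ * (8 * (k₂ * σ)) = (k₁ * σ) ^ 2 := by rw [hk₃]; field_simp
      _ ≤ _ := by gcongr
  have hge : ∀ x, ‖fderiv ℝ w 0‖ ^ 2 / (8 * (k₂ * σ)) ≤ ‖fderiv ℝ w x‖ →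
      k₃ ≤ ‖fderiv ℝ w x‖ / σ := fun x hx => by
    rw [le_div_iff₀ hσ0]
    exact ha3.trans hx
  have key := sq_le_of_le_neg_laplacian (w := w) (ρ := 1) (K := k₂ * σ) (N₀ := k₃ ^ q * B⁻¹)
    (Ls := 2 * (k₂ * σ) + B * (Λ / σ)) (Lw := k₂ ^ q * (|b| * B)) one_pos (by positivity)
    (by positivity) (by positivity)
    (by positivity) hw.contDiffAt hleK (lt_of_lt_of_le (by positivity) ha) (fun x hx hgx => ?_)
    (fun x hx y hy hgx hgy => ?_)
  · refine absurd hG1 (not_lt.2 (key.trans_eq ?_))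
    rw [← hn]
    field_simp
    ring
  · rw [hw.laplacian_eq x hx, neg_neg]
    have h2 := le_exp_mul (b := b) (hw.abs_le hx)
    rw [Real.exp_neg, ← hB] at h2
    have h3 : k₃ ^ q * B⁻¹ ≤ c * ‖fderiv ℝ w x‖ ^ q * Real.exp (b * w x) := by
      rw [hcs _ (norm_nonneg _)]
      have := hge x hgx
      gcongr
    have h4 := sq_nonneg ‖fderiv ℝ w x‖
    linarith
  · rw [hw.laplacian_eq x hx, hw.laplacian_eq y hy, neg_neg, ← sub_eq_add_neg]
    have h2 := hle y hy
    refine (le_abs_self _).trans ((abs_reaction_sub_le (hw.abs_le hx) (hw.abs_le hy)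
      (K := k₂ * σ) (Q := k₂ ^ q) ⟨norm_nonneg _, hleK x hx⟩ ⟨norm_nonneg _, hleK y hy⟩
      ⟨by positivity, by rw [hcs _ (norm_nonneg _)]; gcongr⟩).trans ?_)
    have h5 := hΛ _ ⟨hge x hgx, hle x hx⟩ _ ⟨hge y hgy, h2⟩
    rw [← sub_div, abs_div, abs_of_pos hσ0] at h5
    have h6 := mul_le_mul_of_nonneg_left h5 hB0.le
    have h7 : B * (Λ * (|‖fderiv ℝ w x‖ - ‖fderiv ℝ w y‖| / σ)) =
      B * (Λ / σ) * |‖fderiv ℝ w x‖ - ‖fderiv ℝ w y‖| := by ring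
    rw [h7] at h6
    rw [hcs _ (norm_nonneg _), hcs _ (norm_nonneg _), add_mul, ← hB]
    linarith

theorem IsNormalizedSolution.exists_abs_laplacian_sub_le [FiniteDimensional ℝ E]
    {q : ℝ} (hq : 0 ≤ q) (b c₀ : ℝ) :
    ∃ β : ℝ, 0 < β ∧ β ≤ 1 ∧ ∀ r : ℝ, ∃ K > 0, ∀ (c R : ℝ) (w : E → ℝ), 0 ≤ c → c ≤ c₀ → r + 4 ≤ R →
      IsNormalizedSolution q b c R w → ∀ x ∈ ball (0 : E) r, ∀ y ∈ ball (0 : E) r, ‖x - y‖ ≤ 1 →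
        |Δ w x - Δ w y| ≤ K * ‖x - y‖ ^ β := by
  obtain ⟨H, θ, hH0, hθ0, hθ1, hH⟩ := exists_abs_rpow_sub_rpow_le_rpow hq 2
  refine ⟨θ / 2, by positivity, by linarith, fun r => ?_⟩
  set C : ℝ := Module.finrank ℝ E * 2 + 8 + 1 with hC
  have hC0 : 0 < C := by positivity
  set B := Real.exp (|b| * (2 * (r + 4))) with hB
  have hB0 : 0 < B := Real.exp_pos _
  set Q := max c₀ 0 * 2 ^ q with hQ
  have hQ0 : 0 ≤ Q := by positivity
  refine ⟨2 * 2 * C + B * (max c₀ 0 * (H * C ^ θ)) + Q * (|b| * B) * 2, by positivity,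
    fun c R w hc hc0 hR hw x hx y hy hxy => ?_⟩
  replace hw := hw.mono hR
  have hsub : ball (0 : E) r ⊆ ball 0 (r + 4) := ball_subset_ball (by linarith)
  have hcm : c ≤ max c₀ 0 := hc0.trans (le_max_left _ _)
  have hx' := hsub hx
  have hy' := hsub hy
  have hsub2 : closedBall y 2 ⊆ ball 0 (r + 4) := fun z hz => by
    have h1 := mem_closedBall.1 hz
    have h2 := mem_ball.1 hy
    rw [mem_ball]
    linarith [dist_triangle z y 0]
  have hgrad : ‖fderiv ℝ w x - fderiv ℝ w y‖ ≤ C * √‖x - y‖ := by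
    have := norm_fderiv_add_sub_le (x₀ := y) (h := x - y) (w := w) (L := 2) (F := 8) hxy
      (fun z hz => hw.contDiffAt z (hsub2 hz)) (fun z hz => hw.norm_le z (hsub2 hz))
      (fun z hz => hw.abs_laplacian_le hc (hsub2 hz))
    rwa [add_sub_cancel] at this
  set t := ‖x - y‖ with ht
  have ht0 : 0 ≤ t := norm_nonneg _
  have hs : |‖fderiv ℝ w x‖ - ‖fderiv ℝ w y‖| ≤ C * √t :=
    (abs_norm_sub_norm_le _ _).trans hgrad
  have hsq : √t ^ θ = t ^ (θ / 2) := by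
    rw [Real.sqrt_eq_rpow, ← Real.rpow_mul ht0]
    ring_nf
  have hst : √t ≤ t ^ (θ / 2) := by
    rw [← hsq]
    exact Real.self_le_rpow_of_le_one (Real.sqrt_nonneg _) (Real.sqrt_le_one.2 hxy) hθ1
  have htt : t ≤ t ^ (θ / 2) := Real.self_le_rpow_of_le_one ht0 hxy (by linarith)
  have hpw : |c * ‖fderiv ℝ w x‖ ^ q - c * ‖fderiv ℝ w y‖ ^ q| ≤
      max c₀ 0 * (H * C ^ θ) * t ^ (θ / 2) := by
    rw [← mul_sub, abs_mul, abs_of_nonneg hc, mul_assoc]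
    refine mul_le_mul hcm ?_ (abs_nonneg _) (le_max_right _ _)
    refine (hH _ ⟨norm_nonneg _, hw.norm_le x hx'⟩ _ ⟨norm_nonneg _, hw.norm_le y hy'⟩).trans ?_
    rw [mul_assoc, ← hsq, ← Real.mul_rpow hC0.le (Real.sqrt_nonneg _)]
    gcongr
  have hwxy := hw.abs_sub_le hx' hy'
  rw [hw.laplacian_eq x hx', hw.laplacian_eq y hy', neg_sub_neg, abs_sub_comm]
  have h2 := hw.norm_le y hy'
  refine (abs_reaction_sub_le (hw.abs_le hx') (hw.abs_le hy')
      (K := 2) (Q := Q) ⟨norm_nonneg _, hw.norm_le x hx'⟩ ⟨norm_nonneg _, h2⟩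
      ⟨by positivity, by rw [hQ]; gcongr⟩).trans ?_
  rw [← hB, add_mul, add_mul]
  refine add_le_add_three ?_ ?_ ?_
  · rw [mul_assoc (2 * 2)]
    exact mul_le_mul_of_nonneg_left (hs.trans (by gcongr)) (by norm_num)
  · rw [mul_assoc B]
    gcongr
  · rw [mul_assoc (Q * _)]
    have : |w x - w y| ≤ 2 * t ^ (θ / 2) := hwxy.trans (by gcongr)
    gcongr

theorem exists_entire_of_isNormalizedSolution [FiniteDimensional ℝ E] [Nontrivial E]
    {q b c₁ c₀ : ℝ} (hq : 0 ≤ q) (hc₁ : 0 < c₁) {c : ℕ → ℝ} (hc : ∀ k, c k ∈ Icc c₁ c₀)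
    {w : ℕ → E → ℝ} (hw : ∀ k : ℕ, IsNormalizedSolution q b (c k) k (w k)) :
    ∃ (c' : ℝ) (W : E → ℝ), 0 < c' ∧ ((∀ k, c k = 1) → c' = 1) ∧ ContDiff ℝ 2 W ∧
      (∀ x : E, Δ W x =
        -(‖fderiv ℝ W x‖ ^ 2 + c' * ‖fderiv ℝ W x‖ ^ q * Real.exp (b * W x))) ∧
      ‖fderiv ℝ W 0‖ + √(c' * ‖fderiv ℝ W 0‖ ^ q) = 1 := by
  have hc0 : ∀ k, 0 ≤ c k := fun k => hc₁.le.trans (hc k).1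
  obtain ⟨β, hβ0, hβ1, hK⟩ := IsNormalizedSolution.exists_abs_laplacian_sub_le (E := E) hq b c₀
  set 𝒰 : Ultrafilter ℕ := hyperfilter ℕ with h𝒰
  have hev : ∀ r : ℝ, ∀ᶠ k : ℕ in (𝒰 : Filter ℕ), r ≤ k := fun r =>
    (tendsto_natCast_atTop_atTop.eventually_ge_atTop r).filter_mono Nat.hyperfilter_le_atTop
  obtain ⟨c', hc', hlim⟩ := isCompact_Icc.ultrafilter_le_nhds (𝒰.map c) (by
    rw [le_principal_iff]
    exact mem_map.2 (univ_mem' hc))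
  have hlim : Tendsto c 𝒰 (𝓝 c') := hlim
  obtain ⟨W, hW2, hW⟩ := exists_contDiff_limit (𝒰 := 𝒰) (w := w) (L := 2) (F := 8) hβ0 hβ1
    (fun k => (hw k).zero)
    (fun r => (hev r).mono fun k hk x hx => ((hw k).mono hk).contDiffAt x hx)
    (fun r => (hev r).mono fun k hk x hx => ((hw k).mono hk).norm_le x hx)
    (fun r => (hev r).mono fun k hk x hx => ((hw k).mono hk).abs_laplacian_le (hc0 k) hx)
    (fun r => by
      obtain ⟨K, hK0, hK⟩ := hK r
      exact ⟨K, hK0, (hev (r + 4)).mono fun k hk => hK (c k) k (w k) (hc0 k) (hc k).2 hk (hw k)⟩)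
  have hpow : ∀ x, Tendsto (fun k => c k * ‖fderiv ℝ (w k) x‖ ^ q) 𝒰
      (𝓝 (c' * ‖fderiv ℝ W x‖ ^ q)) := fun x =>
    hlim.mul ((Real.continuousAt_rpow_const _ q (Or.inr hq)).tendsto.comp (hW x).2.1.norm)
  refine ⟨c', W, hc₁.trans_le hc'.1, fun h => ?_, hW2, fun x => ?_, ?_⟩
  · obtain rfl : c = fun _ => 1 := funext h
    exact tendsto_nhds_unique hlim tendsto_const_nhds
  · refine tendsto_nhds_unique (hW x).2.2 ?_
    refine Tendsto.congr' ((hev (‖x‖ + 1)).mono fun k hk =>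
      ((hw k).laplacian_eq x (mem_ball_zero_iff.2 (by linarith))).symm) ?_
    exact (((hW x).2.1.norm.pow 2).add ((hpow x).mul
      ((Real.continuous_exp.tendsto _).comp ((hW x).1.const_mul b)))).neg
  · refine tendsto_nhds_unique ((hW 0).2.1.norm.add (hpow 0).sqrt) ?_
    simp only [(hw _).norm_add_sqrt]
    exact tendsto_const_nhds

theorem exists_radius_not_isNormalizedSolution [FiniteDimensional ℝ E] [Nontrivial E]
    {q b : ℝ} (hq : 0 ≤ q)
    (hL : ∀ c : ℝ, 0 < c → (b = 0 → q = 2 → c = 1) → ∀ W : E → ℝ, ContDiff ℝ 2 W →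
      (∀ x : E, Δ W x =
        -(‖fderiv ℝ W x‖ ^ 2 + c * ‖fderiv ℝ W x‖ ^ q * Real.exp (b * W x))) →
      ∀ x, fderiv ℝ W x = 0) :
    ∃ R > 0, ∀ c : ℝ, 0 < c → (b = 0 → q = 2 → c = 1) → ∀ w : E → ℝ,
      ¬ IsNormalizedSolution q b c R w := by
  obtain ⟨c₁, R₁, hc₁, h₁⟩ := exists_not_isNormalizedSolution_of_le (E := E) hq b
  obtain ⟨c₀, R₀, hc₀, h₀⟩ := exists_not_isNormalizedSolution_of_ge (E := E) hq b
  by_contra! hcon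
  have hex : ∀ k : ℕ, ∃ c : ℝ, ∃ w : E → ℝ, (b = 0 → q = 2 → c = 1) ∧ c ∈ Icc c₁ c₀ ∧
      IsNormalizedSolution q b c k w := fun k => by
    obtain ⟨c, hc, hc1, w, hw⟩ := hcon (max 1 (max k (max R₁ R₀))) (by positivity)
    refine ⟨c, w, hc1, ⟨?_, ?_⟩, hw.mono (by simp)⟩
    · by_contra! h
      exact h₁ c hc h.le w (hw.mono (by simp))
    · by_contra! h
      exact h₀ c h.le w (hw.mono (by simp))
  choose c w hc1 hc hw using hex
  obtain ⟨c', W, hc', hc'1, hW2, hW, hW0⟩ := exists_entire_of_isNormalizedSolution hq hc₁ hc hw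
  have hD := hL c' hc' (fun hb h2 => hc'1 fun k => hc1 k hb h2) W hW2 hW
  rcases hq.eq_or_lt with rfl | hq0
  · have h0 := hW 0
    have hfd : fderiv ℝ W = fun _ => 0 := funext hD
    rw [laplacian_eq_sum_fderiv_fderiv (stdOrthonormalBasis ℝ E), hfd] at h0
    simp at h0
    exact hc'.ne' h0
  · rw [hD 0, norm_zero, Real.zero_rpow hq0.ne'] at hW0
    simp at hW0

theorem HasJet.unique {h : ℝ → ℝ} {a b c a' b' c' : ℝ} (H : HasJet h a b c)
    (H' : HasJet h a' b' c') : b = b' ∧ c = c' := by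
  obtain ⟨g, d, rfl, rfl, e⟩ := H
  obtain ⟨g', d', -, rfl, e'⟩ := H'
  have hg : g =ᶠ[𝓝 0] g' := by filter_upwards [d, d'] with t h1 h2 using h1.unique h2
  exact ⟨hg.self_of_nhds, (e.congr_of_eventuallyEq hg.symm).unique e'⟩

theorem sum_sq_apply_basis [FiniteDimensional ℝ E] {ι : Type*} [Fintype ι]
    (b : OrthonormalBasis ι ℝ E) (ℓ : E →L[ℝ] ℝ) : ∑ i, ℓ (b i) ^ 2 = ‖ℓ‖ ^ 2 := by
  obtain ⟨g, rfl⟩ := (InnerProductSpace.toDual ℝ E).surjective ℓ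
  rw [LinearIsometryEquiv.norm_map, ← real_inner_self_eq_norm_sq, ← sum_inner_basis_mul b]
  simp only [InnerProductSpace.toDual_apply_apply, sq]

section comp

variable {v : E → ℝ} {x : E} {f f' : ℝ → ℝ} {f'' : ℝ}

theorem fderiv_comp_real (hv : DifferentiableAt ℝ v x) (hf : HasDerivAt f (f' (v x)) (v x)) :
    fderiv ℝ (fun y => f (v y)) x = f' (v x) • fderiv ℝ v x :=
  (hf.comp_hasFDerivAt x hv.hasFDerivAt).fderiv

theorem laplacian_comp_real [FiniteDimensional ℝ E] (hv : ContDiffAt ℝ 2 v x) (hf2 : ContDiffAt ℝ 2 f (v x))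
    (hf : ∀ᶠ s in 𝓝 (v x), HasDerivAt f (f' s) s) (hf' : HasDerivAt f' f'' (v x)) :
    Δ (fun y => f (v y)) x = f' (v x) * Δ v x + f'' * ‖fderiv ℝ v x‖ ^ 2 := by
  let b := stdOrthonormalBasis ℝ E
  rw [laplacian_eq_sum_fderiv_fderiv b, laplacian_eq_sum_fderiv_fderiv b, ← sum_sq_apply_basis b,
    Finset.mul_sum, Finset.mul_sum, ← Finset.sum_add_distrib]
  refine Finset.sum_congr rfl fun i _ => ?_
  have h1 := (hf2.comp x hv).hasJet (b i)
  have h2 := (hv.hasJet (b i)).comp hf hf'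
  refine (h1.unique h2).2.trans ?_
  ring

theorem fderiv_comp_affine (v : E → ℝ) (a : E) (r : ℝ) (y : E)
    (hv : DifferentiableAt ℝ v (a + r • y)) :
    fderiv ℝ (fun y => v (a + r • y)) y = r • fderiv ℝ v (a + r • y) := by
  have h1 : HasFDerivAt (fun y : E => a + r • y) (r • ContinuousLinearMap.id ℝ E) y :=
    ((hasFDerivAt_id y).const_smul r).const_add a
  refine (hv.hasFDerivAt.comp y h1).fderiv.trans ?_
  ext; simp

theorem laplacian_comp_affine [FiniteDimensional ℝ E] {v : E → ℝ} {a : E} {r : ℝ} {y : E}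
    (hv : ContDiffAt ℝ 2 v (a + r • y)) :
    Δ (fun y => v (a + r • y)) y = r ^ 2 * Δ v (a + r • y) := by
  let b := stdOrthonormalBasis ℝ E
  rw [laplacian_eq_sum_fderiv_fderiv b, laplacian_eq_sum_fderiv_fderiv b, Finset.mul_sum]
  refine Finset.sum_congr rfl fun i _ => ?_
  have h0 : ContDiffAt ℝ 2 (fun y : E => a + r • y) y := by fun_prop
  have h1 := (ContDiffAt.comp y hv h0).hasJet (b i)
  have h2 := hv.hasJet (r • b i)
  have e : (fun t : ℝ => (v ∘ fun y => a + r • y) (y + t • b i)) =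
      fun t => v (a + r • y + t • r • b i) := by
    ext t
    simp only [Function.comp]
    congr 1
    module
  rw [e] at h1
  have := (h1.unique h2).2
  simp only [map_smul, smul_apply, smul_eq_mul] at this
  refine this.trans ?_
  ring

end comp

section scaling

variable {u : E → ℝ} {p q r : ℝ} {a y : E}

theorem contDiffAt_log_comp_affine (hu : ContDiffAt ℝ 2 u (a + r • y)) (h0 : 0 < u (a + r • y)) :
    ContDiffAt ℝ 2 (fun y => Real.log (u (a + r • y)) - Real.log (u a)) y := by
  have h1 : ContDiffAt ℝ 2 (fun y : E => a + r • y) y := by fun_prop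
  exact ((ContDiffAt.comp y hu h1).log h0.ne').sub contDiffAt_const

theorem fderiv_log_comp_affine (hu : ContDiffAt ℝ 2 u (a + r • y)) (h0 : 0 < u (a + r • y)) :
    fderiv ℝ (fun y => Real.log (u (a + r • y)) - Real.log (u a)) y =
      (r / u (a + r • y)) • fderiv ℝ u (a + r • y) := by
  have hd : DifferentiableAt ℝ u (a + r • y) := hu.differentiableAt (by simp)
  have hd' : DifferentiableAt ℝ (fun y => u (a + r • y)) y :=
    DifferentiableAt.comp y hd (by fun_prop)
  rw [fderiv_sub_const, fderiv.log hd' h0.ne', fderiv_comp_affine u a r y hd, smul_smul]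
  congr 1
  ring

theorem laplacian_log_comp_affine [FiniteDimensional ℝ E]
    (hu : ContDiffAt ℝ 2 u (a + r • y)) (h0 : 0 < u (a + r • y)) :
    Δ (fun y => Real.log (u (a + r • y)) - Real.log (u a)) y =
      r ^ 2 * (Δ u (a + r • y) / u (a + r • y)
        - ‖fderiv ℝ u (a + r • y)‖ ^ 2 / u (a + r • y) ^ 2) := by
  have h2 : ContDiffAt ℝ 2 (fun s => Real.log s - Real.log (u a)) (u (a + r • y)) :=
    (Real.contDiffAt_log.2 h0.ne').sub contDiffAt_const
  have h3 := laplacian_comp_real (f' := fun s => s⁻¹) (f'' := -(u (a + r • y) ^ 2)⁻¹) hu h2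
    (by
      filter_upwards [eventually_gt_nhds h0] with s hs
      exact (Real.hasDerivAt_log hs.ne').sub_const _)
    (hasDerivAt_inv h0.ne')
  rw [laplacian_comp_affine (v := fun x => Real.log (u x) - Real.log (u a))
    (ContDiffAt.comp _ h2 hu), h3]
  ring

end scaling

theorem rpow_mul_rpow_eq_rescaled {p q r s U U₀ : ℝ} (hr : 0 < r) (hs : 0 ≤ s) (hU : 0 < U)
    (hU₀ : 0 < U₀) :
    r ^ (2 - q) * U₀ ^ (p + q - 1) * (r / U * s) ^ q
      * Real.exp ((p + q - 1) * (Real.log U - Real.log U₀)) = r ^ 2 * (s ^ q * U ^ (p - 1)) := by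
  have e1 : Real.exp ((p + q - 1) * (Real.log U - Real.log U₀)) =
      U ^ (p + q - 1) / U₀ ^ (p + q - 1) := by
    rw [Real.rpow_def_of_pos hU, Real.rpow_def_of_pos hU₀, ← Real.exp_sub]
    ring_nf
  have e2 : U ^ (p + q - 1) = U ^ (p - 1) * U ^ q := by
    rw [← Real.rpow_add hU]; ring_nf
  have e3 : r ^ (2 - q) = r ^ 2 / r ^ q := by
    rw [Real.rpow_sub hr, Real.rpow_two]
  rw [e1, e2, e3, Real.mul_rpow (by positivity) hs, Real.div_rpow hr.le hU.le]
  have : U₀ ^ (p + q - 1) ≠ 0 := (Real.rpow_pos_of_pos hU₀ _).ne'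
  have : r ^ q ≠ 0 := (Real.rpow_pos_of_pos hr _).ne'
  have : U ^ q ≠ 0 := (Real.rpow_pos_of_pos hU _).ne'
  field_simp

/-- The quantity controlled by the gradient estimate, homogeneous of degree one under scaling. -/
noncomputable def gradientSize (p q : ℝ) (u : E → ℝ) (x : E) : ℝ :=
  ‖fderiv ℝ u x‖ / u x + √(‖fderiv ℝ u x‖ ^ q * u x ^ (p - 1))

theorem isNormalizedSolution_of_gradientSize_le [FiniteDimensional ℝ E] {u : E → ℝ} {p q R : ℝ}
    {a : E} (hR : 0 < R)
    (hM : 0 < gradientSize p q u a)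
    (hu : ∀ z ∈ ball a (R / gradientSize p q u a), ContDiffAt ℝ 2 u z)
    (hpos : ∀ z ∈ ball a (R / gradientSize p q u a), 0 < u z)
    (heq : ∀ z ∈ ball a (R / gradientSize p q u a), Δ u z + ‖fderiv ℝ u z‖ ^ q * u z ^ p = 0)
    (hle : ∀ z ∈ ball a (R / gradientSize p q u a),
      gradientSize p q u z ≤ 2 * gradientSize p q u a) :
    IsNormalizedSolution q (p + q - 1)
      ((gradientSize p q u a)⁻¹ ^ (2 - q) * u a ^ (p + q - 1)) R
      (fun y => Real.log (u (a + (gradientSize p q u a)⁻¹ • y)) - Real.log (u a)) := by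
  set M := gradientSize p q u a with hMdef
  set r := M⁻¹ with hr
  have hr0 : 0 < r := inv_pos.2 hM
  have hrM : r * M = 1 := inv_mul_cancel₀ hM.ne'
  have hmem : ∀ y ∈ ball (0 : E) R, a + r • y ∈ ball a (R / M) := fun y hy => by
    rw [mem_ball_zero_iff] at hy
    rw [mem_ball, dist_eq_norm, add_sub_cancel_left, norm_smul, Real.norm_of_nonneg hr0.le,
      div_eq_inv_mul]
    exact mul_lt_mul_of_pos_left hy hr0
  have ha : 0 < u a := hpos a (mem_ball_self (by positivity))
  have hfd : ∀ y ∈ ball (0 : E) R,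
      ‖fderiv ℝ (fun y => Real.log (u (a + r • y)) - Real.log (u a)) y‖ =
        r / u (a + r • y) * ‖fderiv ℝ u (a + r • y)‖ := fun y hy => by
    have h0 := hpos _ (hmem y hy)
    rw [fderiv_log_comp_affine (hu _ (hmem y hy)) h0, norm_smul, Real.norm_of_nonneg (by positivity)]
  have hre : ∀ y ∈ ball (0 : E) R, r ^ (2 - q) * u a ^ (p + q - 1)
      * ‖fderiv ℝ (fun y => Real.log (u (a + r • y)) - Real.log (u a)) y‖ ^ q
      * Real.exp ((p + q - 1) * (Real.log (u (a + r • y)) - Real.log (u a))) =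
      r ^ 2 * (‖fderiv ℝ u (a + r • y)‖ ^ q * u (a + r • y) ^ (p - 1)) := fun y hy => by
    rw [hfd y hy]
    exact rpow_mul_rpow_eq_rescaled hr0 (norm_nonneg _) (hpos _ (hmem y hy)) ha
  have hbd : ∀ y ∈ ball (0 : E) R, r * gradientSize p q u (a + r • y) ≤ 2 := fun y hy => by
    have := mul_le_mul_of_nonneg_left (hle _ (hmem y hy)) hr0.le
    linarith
  have h0R : (0 : E) ∈ ball (0 : E) R := mem_ball_self hR
  refine ⟨fun y hy => contDiffAt_log_comp_affine (hu _ (hmem y hy)) (hpos _ (hmem y hy)),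
    fun y hy => ?_, by simp, fun y hy => ?_, fun y hy => ?_, ?_⟩
  · have h0 := hpos _ (hmem y hy)
    rw [hre y hy, hfd y hy, laplacian_log_comp_affine (hu _ (hmem y hy)) h0,
      eq_neg_of_add_eq_zero_left (heq _ (hmem y hy)), Real.rpow_sub_one h0.ne']
    field_simp
    ring
  · rw [hfd y hy]
    refine le_trans ?_ (hbd y hy)
    rw [gradientSize, mul_add, div_mul_eq_mul_div, mul_div_assoc]
    have := Real.sqrt_nonneg (‖fderiv ℝ u (a + r • y)‖ ^ q * u (a + r • y) ^ (p - 1))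
    have := mul_nonneg hr0.le this
    linarith
  · rw [hre y hy]
    have h0 := hpos _ (hmem y hy)
    have h1 : 0 ≤ ‖fderiv ℝ u (a + r • y)‖ ^ q * u (a + r • y) ^ (p - 1) := by positivity
    have h2 : r * √(‖fderiv ℝ u (a + r • y)‖ ^ q * u (a + r • y) ^ (p - 1)) ≤ 2 := by
      refine le_trans ?_ (hbd y hy)
      rw [gradientSize]
      have : 0 ≤ ‖fderiv ℝ u (a + r • y)‖ / u (a + r • y) := by positivity
      gcongr
      linarith
    calc _ = (r * √(‖fderiv ℝ u (a + r • y)‖ ^ q * u (a + r • y) ^ (p - 1))) ^ 2 := by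
          rw [mul_pow, Real.sq_sqrt h1]
      _ ≤ 2 ^ 2 := by gcongr
      _ = 4 := by norm_num
  · have h1 := hre 0 h0R
    have h2 := hfd 0 h0R
    simp only [smul_zero, add_zero, sub_self, mul_zero, Real.exp_zero, mul_one] at h1 h2
    rw [h1, h2, Real.sqrt_mul (sq_nonneg r), Real.sqrt_sq hr0.le]
    refine Eq.trans ?_ hrM
    rw [hMdef, gradientSize]
    ring

theorem continuousOn_gradientSize [FiniteDimensional ℝ E] {u : E → ℝ} {p q : ℝ} (hq : 0 ≤ q)
    {S : Set E} (hu : ∀ z ∈ S, ContDiffAt ℝ 2 u z) (hpos : ∀ z ∈ S, 0 < u z) :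
    ContinuousOn (gradientSize p q u) S := fun z hz => by
  have h1 : ContinuousAt (fun z => ‖fderiv ℝ u z‖) z :=
    ((hu z hz).fderiv_right (m := 1) (by norm_num)).continuousAt.norm
  have h2 : ContinuousAt u z := (hu z hz).continuousAt
  have h0 := hpos z hz
  exact ((h1.div h2 h0.ne').add ((h1.rpow_const (Or.inr hq)).mul
    (h2.rpow_const (Or.inl h0.ne'))).sqrt).continuousWithinAt

/-- Point selection: if the size is large compared with the distance, there is a point around
which it is at most doubled on a ball of the natural scale. -/
theorem exists_doubling_ball [ProperSpace E] {M : E → ℝ} {x : E} {d R : ℝ} (hR : 0 < R)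
    (hM0 : ∀ z ∈ ball x d, 0 ≤ M z) (hM : ContinuousOn M (ball x d)) (hx : 4 * R < M x * d)
    (hd : 0 < d) :
    ∃ a, 0 < M a ∧ ball a (R / M a) ⊆ ball x d ∧ ∀ z ∈ ball a (R / M a), M z ≤ 2 * M a := by
  have hsub : closedBall x (d / 2) ⊆ ball x d := closedBall_subset_ball (by linarith)
  obtain ⟨a, ha, hmax⟩ := (isCompact_closedBall x (d / 2)).exists_isMaxOn
    (f := fun z => M z * (d / 2 - dist z x)) ⟨x, mem_closedBall_self (by positivity)⟩
    ((hM.mono hsub).mul (by fun_prop))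
  have h1 : M x * (d / 2) ≤ M a * (d / 2 - dist a x) := by
    simpa using hmax (mem_closedBall_self (x := x) (ε := d / 2) (by positivity))
  set τ := d / 2 - dist a x with hτ
  have hτ0 : 0 ≤ τ := sub_nonneg.2 (mem_closedBall.1 ha)
  have hMa0 := hM0 a (hsub ha)
  have h2 : 2 * R < M a * τ := by linarith
  have hMa : 0 < M a := by
    by_contra! h
    nlinarith
  have hRτ : R / M a < τ / 2 := by
    rw [div_lt_iff₀ hMa]
    linarith
  have hz : ∀ z ∈ ball a (R / M a), τ / 2 ≤ d / 2 - dist z x := fun z hz => by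
    have h3 := mem_ball.1 hz
    have := dist_triangle z a x
    linarith
  have hzc : ∀ z ∈ ball a (R / M a), z ∈ closedBall x (d / 2) := fun z hz' => by
    rw [mem_closedBall]
    linarith [hz z hz']
  refine ⟨a, hMa, fun z hz' => hsub (hzc z hz'), fun z hz' => ?_⟩
  have h4 : M z * (d / 2 - dist z x) ≤ M a * τ := hmax (hzc z hz')
  have h5 := mul_le_mul_of_nonneg_left (hz z hz') (hM0 z (hsub (hzc z hz')))
  have hτ1 : 0 < τ := by
    have : 0 < R / M a := by positivity
    linarith
  nlinarith

theorem ball_infDist_frontier_subset {Ω : Set E} (hΩ : IsOpen Ω) {x : E} (hx : x ∈ Ω) :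
    ball x (infDist x (frontier Ω)) ⊆ Ω := by
  rcases le_or_gt (infDist x (frontier Ω)) 0 with h | h
  · rw [ball_eq_empty.2 h]
    exact empty_subset _
  refine (isPreconnected_ball (x := x)).subset_of_closure_inter_subset hΩ ⟨x, mem_ball_self h, hx⟩
    fun z hz => ?_
  by_contra hzΩ
  have h1 : z ∈ frontier Ω := by
    rw [hΩ.frontier_eq]
    exact ⟨hz.1, hzΩ⟩
  have h2 := infDist_le_dist_of_mem (x := x) h1
  have h3 := mem_ball'.1 hz.2
  linarith

theorem exists_scaling {b c q : ℝ} (hc : 0 < c) (h : b = 0 → q = 2 → c = 1) :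
    ∃ r α : ℝ, 0 < r ∧ r ^ q * Real.exp (b * α) = r ^ 2 * c := by
  rcases eq_or_ne b 0 with rfl | hb
  · rcases eq_or_ne q 2 with rfl | hq
    · exact ⟨1, 0, one_pos, by simp [h rfl rfl]⟩
    · refine ⟨c ^ (q - 2)⁻¹, 0, by positivity, ?_⟩
      have h1 : (c ^ (q - 2)⁻¹) ^ (q - 2) = c := Real.rpow_inv_rpow hc.le (sub_ne_zero.2 hq)
      have h2 : (c ^ (q - 2)⁻¹) ^ q = (c ^ (q - 2)⁻¹) ^ (2 : ℝ) * (c ^ (q - 2)⁻¹) ^ (q - 2) := by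
        rw [← Real.rpow_add (by positivity)]
        ring_nf
      rw [h2, h1, Real.rpow_two]
      simp
  · refine ⟨1, Real.log c / b, one_pos, ?_⟩
    rw [mul_div_cancel₀ _ hb, Real.exp_log hc]
    simp

theorem fderiv_eq_zero_of_liouville [FiniteDimensional ℝ E] {p q : ℝ}
    (hLiou : ∀ u : E → ℝ, ContDiff ℝ 2 u → (∀ x, 0 < u x) →
      (∀ x, Δ u x + ‖fderiv ℝ u x‖ ^ q * u x ^ p = 0) → ∀ x y, u x = u y)
    {c : ℝ} (hc : 0 < c) (h : p + q - 1 = 0 → q = 2 → c = 1) {W : E → ℝ} (hW : ContDiff ℝ 2 W)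
    (heq : ∀ x : E, Δ W x =
        -(‖fderiv ℝ W x‖ ^ 2 + c * ‖fderiv ℝ W x‖ ^ q * Real.exp ((p + q - 1) * W x))) (x : E) :
    fderiv ℝ W x = 0 := by
  obtain ⟨r, α, hr, hrα⟩ := exists_scaling hc h
  have hV : ContDiff ℝ 2 (fun y : E => W ((0 : E) + r • y)) := hW.comp (by fun_prop)
  have hd : ∀ t, HasDerivAt (fun t => Real.exp (t + α)) (Real.exp (t + α)) t := fun t => by
    simpa using ((hasDerivAt_id t).add_const α).exp
  have hconst := hLiou (fun y => Real.exp (W ((0 : E) + r • y) + α))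
    (Real.contDiff_exp.comp (hV.add contDiff_const)) (fun y => Real.exp_pos _) (fun y => by
      have h1 := laplacian_comp_real (f := fun t => Real.exp (t + α))
        (f' := fun t => Real.exp (t + α)) (hV.contDiffAt (x := y))
        (by fun_prop) (Eventually.of_forall hd) (hd _)
      have h2 := fderiv_comp_real (f := fun t => Real.exp (t + α))
        (f' := fun t => Real.exp (t + α)) ((hV.differentiable (by simp)) y) (hd _)
      rw [h1, h2, laplacian_comp_affine hW.contDiffAt,
        fderiv_comp_affine W 0 r y (hW.differentiable (by simp) _), heq]
      set s := ‖fderiv ℝ W ((0 : E) + r • y)‖ with hs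
      set t := W ((0 : E) + r • y) with ht
      have hs0 : 0 ≤ s := norm_nonneg _
      rw [norm_smul (Real.exp _), norm_smul r, Real.norm_of_nonneg (Real.exp_pos _).le, Real.norm_of_nonneg hr.le,
        ← hs, Real.mul_rpow (Real.exp_pos _).le (by positivity), Real.mul_rpow hr.le hs0]
      have e1 : Real.exp (t + α) ^ q * Real.exp (t + α) ^ p =
          Real.exp (t + α) * (Real.exp ((p + q - 1) * t) * Real.exp ((p + q - 1) * α)) := by
        rw [← Real.exp_mul, ← Real.exp_mul, ← Real.exp_add, ← Real.exp_add, ← Real.exp_add]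
        ring_nf
      linear_combination r ^ q * s ^ q * e1
        + Real.exp (t + α) * Real.exp ((p + q - 1) * t) * s ^ q * hrα)
  have hW0 : ∀ z, W z = W 0 := fun z => by
    have := hconst (r⁻¹ • z) 0
    simpa [smul_smul, mul_inv_cancel₀ hr.ne'] using this
  rw [show W = fun _ => W 0 from funext hW0]
  simp

theorem exists_gradient_estimate [FiniteDimensional ℝ E] [Nontrivial E] {p q : ℝ} (hq : 0 ≤ q)
    (hLiou : ∀ u : E → ℝ, ContDiff ℝ 2 u → (∀ x, 0 < u x) →
      (∀ x, Δ u x + ‖fderiv ℝ u x‖ ^ q * u x ^ p = 0) → ∀ x y, u x = u y) :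
    ∃ C > (0 : ℝ), ∀ (u : E → ℝ) (x : E) (d : ℝ), 0 < d →
      (∀ z ∈ ball x d, ContDiffAt ℝ 2 u z) → (∀ z ∈ ball x d, 0 < u z) →
      (∀ z ∈ ball x d, Δ u z + ‖fderiv ℝ u z‖ ^ q * u z ^ p = 0) →
      ‖fderiv ℝ u x‖ ^ 2 / u x ^ 2 + ‖fderiv ℝ u x‖ ^ q * u x ^ (p - 1) ≤ C / d ^ 2 := by
  have : ProperSpace E := FiniteDimensional.proper ℝ E
  obtain ⟨R, hR, hno⟩ := exists_radius_not_isNormalizedSolution (E := E) (b := p + q - 1) hq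
    fun c hc h W hW heq x => fderiv_eq_zero_of_liouville hLiou hc h hW heq x
  refine ⟨(4 * R) ^ 2, by positivity, fun u x d hd hu hpos heq => ?_⟩
  have hM0 : ∀ z ∈ ball x d, 0 ≤ gradientSize p q u z := fun z hz =>
    add_nonneg (div_nonneg (norm_nonneg _) (hpos z hz).le) (Real.sqrt_nonneg _)
  have hxd : x ∈ ball x d := mem_ball_self hd
  have hle : gradientSize p q u x * d ≤ 4 * R := by
    by_contra! hlt
    obtain ⟨a, ha, hsub, hdbl⟩ := exists_doubling_ball hR hM0
      (continuousOn_gradientSize hq hu hpos) hlt hd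
    have hua : 0 < u a := hpos a (hsub (mem_ball_self (by positivity)))
    refine hno _ (by positivity) (fun hb h2 => ?_) _ (isNormalizedSolution_of_gradientSize_le hR ha
      (fun z hz => hu z (hsub hz)) (fun z hz => hpos z (hsub hz)) (fun z hz => heq z (hsub hz)) hdbl)
    rw [hb, h2]
    simp
  have hux := hpos x hxd
  have h1 : 0 ≤ ‖fderiv ℝ u x‖ ^ q * u x ^ (p - 1) := by positivity
  have h2 : 0 ≤ ‖fderiv ℝ u x‖ / u x := by positivity
  rw [le_div_iff₀ (by positivity)]
  calc _ = ((‖fderiv ℝ u x‖ / u x) ^ 2 + √(‖fderiv ℝ u x‖ ^ q * u x ^ (p - 1)) ^ 2) * d ^ 2 := by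
        rw [Real.sq_sqrt h1, div_pow]
    _ ≤ gradientSize p q u x ^ 2 * d ^ 2 := by
        gcongr
        rw [gradientSize]
        nlinarith [mul_nonneg h2 (Real.sqrt_nonneg (‖fderiv ℝ u x‖ ^ q * u x ^ (p - 1)))]
    _ = (gradientSize p q u x * d) ^ 2 := by ring
    _ ≤ (4 * R) ^ 2 := by
        have := mul_nonneg (hM0 x hxd) hd.le
        gcongr

theorem norm_gradient_eq [CompleteSpace E] (u : E → ℝ) (x : E) : ‖gradient u x‖ = ‖fderiv ℝ u x‖ :=
  LinearIsometryEquiv.norm_map _ _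

theorem elaplacian_eq_laplacian {n : ℕ} {u : EuclideanSpace ℝ (Fin n) → ℝ}
    {x : EuclideanSpace ℝ (Fin n)} (hu : ContDiffAt ℝ 2 u x) : elaplacian u x = Δ u x := by
  rw [laplacian_eq_sum_fderiv_fderiv (EuclideanSpace.basisFun (Fin n) ℝ)]
  have hd : DifferentiableAt ℝ (fderiv ℝ u) x :=
    (hu.fderiv_right (m := 1) (by norm_num)).differentiableAt (by simp)
  refine Finset.sum_congr rfl fun i _ => ?_
  rw [EuclideanSpace.basisFun_apply, fderiv_clm_apply hd (differentiableAt_const _)]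
  simp

end

/-- **Theorem 1.4.** If the Liouville property holds for `(p,q)` in dimension `n`, then
there is a constant `C = C(n,p,q) > 0` such that every positive classical solution of
`Δu + |∇u|^q u^p = 0` on a domain `Ω ⊊ ℝⁿ` with nonempty boundary satisfies
`|∇u|²/u² + |∇u|^q u^(p−1) ≤ C / dist(x, ∂Ω)²` on `Ω`. -/
theorem gradient_estimate_of_liouville (n : ℕ) (hn : 2 ≤ n) (p q : ℝ) (hq : 0 ≤ q)
    (hLiou : ∀ u : EuclideanSpace ℝ (Fin n) → ℝ,
      ContDiff ℝ 2 u → (∀ x, 0 < u x) →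
      (∀ x, elaplacian u x + ‖gradient u x‖ ^ q * u x ^ p = 0) →
      ∀ x y, u x = u y) :
    ∃ C > (0 : ℝ), ∀ Ω : Set (EuclideanSpace ℝ (Fin n)),
      IsOpen Ω → IsConnected Ω → Ω ≠ Set.univ → (frontier Ω).Nonempty →
      ∀ u : EuclideanSpace ℝ (Fin n) → ℝ,
        ContDiffOn ℝ 2 u Ω → (∀ x ∈ Ω, 0 < u x) →
        (∀ x ∈ Ω, elaplacian u x + ‖gradient u x‖ ^ q * u x ^ p = 0) →
        ∀ x ∈ Ω,
          ‖gradient u x‖ ^ 2 / u x ^ 2 + ‖gradient u x‖ ^ q * u x ^ (p - 1)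
            ≤ C / Metric.infDist x (frontier Ω) ^ 2 := by
  have : NeZero n := ⟨by omega⟩
  simp only [norm_gradient_eq] at hLiou ⊢
  obtain ⟨C, hC, h⟩ := exists_gradient_estimate (E := EuclideanSpace ℝ (Fin n)) (p := p) hq
    fun u hu hpos heq => hLiou u hu hpos fun x => by
      rw [elaplacian_eq_laplacian hu.contDiffAt]
      exact heq x
  refine ⟨C, hC, fun Ω hΩ _ _ hne u hu hpos heq x hx => ?_⟩
  have hsub := ball_infDist_frontier_subset hΩ hx
  have hu' : ∀ z ∈ Ω, ContDiffAt ℝ 2 u z := fun z hz => hu.contDiffAt (hΩ.mem_nhds hz)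
  refine h u x _ ?_ (fun z hz => hu' z (hsub hz)) (fun z hz => hpos z (hsub hz)) fun z hz => ?_
  · refine (isClosed_frontier.notMem_iff_infDist_pos hne).1 fun hxf => ?_
    rw [hΩ.frontier_eq] at hxf
    exact hxf.2 hx
  · rw [← elaplacian_eq_laplacian (hu' z (hsub hz))]
    exact heq z (hsub hz)
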